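/- (Faltings Vanishing) Let R be a complete equicharacteristic regular local ring of dimension n whose residue field is separably closed, and let I be a nonzero proper ideal of R. Let c be the biggest height of any minimal prime of I. Then lcd_R(I) ≤ n − ⌊(n−1)/c⌋, i.e., H^j_I(R) = 0 for all j > n − ⌊(n−1)/c⌋. -/

import Mathlib

open CategoryTheory

namespace FV

section Basic

variable {R : Type} [CommRing R]

/-- `X` is finitely generated and killed by a power of `I`. -/
structure IsTors (I : Ideal R) (X : ModuleCat.{0} R) : Prop where
  finite : Module.Finite R X
  kill : ∃ s : ℕ, ∀ a ∈ I ^ s, ∀ x : X, a • x = 0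

/-- Effaceability form of the vanishing of `H^j_I(M)`. -/
def Van (I : Ideal R) (j : ℕ) (M : ModuleCat.{0} R) : Prop :=
  ∀ X : ModuleCat.{0} R, IsTors I X → ∀ ξ : Abelian.Ext X M j,
    ∃ (X' : ModuleCat.{0} R) (p : X' ⟶ X), IsTors I X' ∧ Function.Surjective p ∧
      (Abelian.Ext.mk₀ p).comp ξ (zero_add j) = 0

variable {I : Ideal R}

lemma Van.of_shortExact₂ {S : ShortComplex (ModuleCat.{0} R)} (hS : S.ShortExact) {j : ℕ}
    (h₁ : Van I j S.X₁) (h₃ : Van I j S.X₃) : Van I j S.X₂ := by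
  intro X hX ξ
  obtain ⟨X₁, p, hX₁, hp, h⟩ := h₃ X hX (ξ.comp (.mk₀ S.g) (add_zero j))
  rw [← Abelian.Ext.comp_assoc_of_third_deg_zero] at h
  obtain ⟨η, hη⟩ := Abelian.Ext.covariant_sequence_exact₂ _ hS _ h
  obtain ⟨X₂, q, hX₂, hq, h'⟩ := h₁ X₁ hX₁ η
  refine ⟨X₂, q ≫ p, hX₂, by simpa using hp.comp hq, ?_⟩
  rw [← Abelian.Ext.mk₀_comp_mk₀, Abelian.Ext.comp_assoc_of_second_deg_zero, ← hη,
    ← Abelian.Ext.comp_assoc_of_third_deg_zero, h', Abelian.Ext.zero_comp]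

lemma Van.of_shortExact₃ {S : ShortComplex (ModuleCat.{0} R)} (hS : S.ShortExact) {j : ℕ}
    (h₁ : Van I (j + 1) S.X₁) (h₂ : Van I j S.X₂) : Van I j S.X₃ := by
  intro X hX ξ
  obtain ⟨X₁, p, hX₁, hp, h⟩ := h₁ X hX (ξ.comp hS.extClass rfl)
  rw [← Abelian.Ext.comp_assoc _ _ _ (zero_add j) rfl (by lia)] at h
  obtain ⟨η, hη⟩ := Abelian.Ext.covariant_sequence_exact₃ _ hS _ rfl h
  obtain ⟨X₂, q, hX₂, hq, h'⟩ := h₂ X₁ hX₁ η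
  refine ⟨X₂, q ≫ p, hX₂, by simpa using hp.comp hq, ?_⟩
  rw [← Abelian.Ext.mk₀_comp_mk₀, Abelian.Ext.comp_assoc_of_second_deg_zero, ← hη,
    ← Abelian.Ext.comp_assoc_of_third_deg_zero, h', Abelian.Ext.zero_comp]

lemma Van.of_shortExact₁ {S : ShortComplex (ModuleCat.{0} R)} (hS : S.ShortExact) {j : ℕ}
    (h₃ : Van I j S.X₃) (h₂ : Van I (j + 1) S.X₂) : Van I (j + 1) S.X₁ := by
  intro X hX ξ
  obtain ⟨X₁, p, hX₁, hp, h⟩ := h₂ X hX (ξ.comp (.mk₀ S.f) (add_zero _))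
  rw [← Abelian.Ext.comp_assoc_of_third_deg_zero] at h
  obtain ⟨η, hη⟩ := Abelian.Ext.covariant_sequence_exact₁ _ hS _ h rfl
  obtain ⟨X₂, q, hX₂, hq, h'⟩ := h₃ X₁ hX₁ η
  refine ⟨X₂, q ≫ p, hX₂, by simpa using hp.comp hq, ?_⟩
  rw [← Abelian.Ext.mk₀_comp_mk₀, Abelian.Ext.comp_assoc_of_second_deg_zero, ← hη,
    ← Abelian.Ext.comp_assoc _ _ _ (zero_add j) rfl (by lia), h', Abelian.Ext.zero_comp]

lemma Van.of_injective (M : ModuleCat.{0} R) [Injective M] (j : ℕ) : Van I (j + 1) M := by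
  intro X hX ξ
  refine ⟨X, 𝟙 X, hX, Function.surjective_id, ?_⟩
  rw [Abelian.Ext.eq_zero_of_injective ξ, Abelian.Ext.comp_zero]

lemma Van.succ_iff {S : ShortComplex (ModuleCat.{0} R)} (hS : S.ShortExact)
    (hinj : ∀ j, Van I (j + 1) S.X₂) {j : ℕ} :
    Van I (j + 2) S.X₁ ↔ Van I (j + 1) S.X₃ :=
  ⟨fun h ↦ .of_shortExact₃ hS h (hinj _), fun h ↦ .of_shortExact₁ hS h (hinj _)⟩

lemma Van.of_iso {M N : ModuleCat.{0} R} (e : M ≅ N) {j : ℕ} (h : Van I j M) : Van I j N := by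
  intro X hX ξ
  obtain ⟨X₁, p, hX₁, hp, h⟩ := h X hX (ξ.comp (.mk₀ e.inv) (add_zero _))
  refine ⟨X₁, p, hX₁, hp, ?_⟩
  rw [← Abelian.Ext.comp_assoc_of_third_deg_zero] at h
  have := congrArg (fun z ↦ Abelian.Ext.comp z (.mk₀ e.hom) (add_zero _)) h
  simpa using this

lemma IsTors.of_surjective {X Y : ModuleCat.{0} R} (h : IsTors I X) (f : X ⟶ Y)
    (hf : Function.Surjective f) : IsTors I Y := by
  obtain ⟨h₁, s, hs⟩ := h
  refine ⟨Module.Finite.of_surjective f.hom hf, s, fun a ha y ↦ ?_⟩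
  obtain ⟨x, rfl⟩ := hf y
  change a • f.hom x = 0
  rw [← map_smul, hs a ha, map_zero]

lemma IsTors.of_injective [IsNoetherianRing R] {X Y : ModuleCat.{0} R} (h : IsTors I Y) (f : X ⟶ Y)
    (hf : Function.Injective f) : IsTors I X := by
  obtain ⟨h₁, s, hs⟩ := h
  refine ⟨Module.Finite.of_injective f.hom hf, s, fun a ha y ↦ hf ?_⟩
  change f.hom _ = f.hom _
  rw [map_smul, map_zero]
  exact hs a ha _

lemma IsTors.mono {J : Ideal R} {s : ℕ} (hIJ : J ^ s ≤ I) {X : ModuleCat.{0} R} (h : IsTors I X) :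
    IsTors J X := by
  obtain ⟨h₁, t, ht⟩ := h
  refine ⟨h₁, s * t, fun a ha ↦ ht a ?_⟩
  rw [pow_mul] at ha
  exact Ideal.pow_right_mono hIJ t ha

lemma isTors_congr [IsNoetherianRing R] {J : Ideal R} (h : I.radical = J.radical)
    {X : ModuleCat.{0} R} : IsTors I X ↔ IsTors J X := by
  obtain ⟨s, hs⟩ := Ideal.exists_pow_le_of_le_radical_of_fg (I := I) (J := J)
    (by rw [← h]; exact Ideal.le_radical) (IsNoetherian.noetherian I)
  obtain ⟨t, ht⟩ := Ideal.exists_pow_le_of_le_radical_of_fg (I := J) (J := I)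
    (by rw [h]; exact Ideal.le_radical) (IsNoetherian.noetherian J)
  exact ⟨.mono ht, .mono hs⟩

lemma van_congr [IsNoetherianRing R] {J : Ideal R} (h : I.radical = J.radical) {j : ℕ}
    {M : ModuleCat.{0} R} : Van I j M ↔ Van J j M := by
  simp only [Van, isTors_congr h]

/-- The `I`-torsion submodule. -/
def Gam (I : Ideal R) (M : Type) [AddCommGroup M] [Module R M] : Submodule R M where
  carrier := {x | ∃ s : ℕ, ∀ a ∈ I ^ s, a • x = 0}
  add_mem' := by
    rintro x y ⟨s, hs⟩ ⟨t, ht⟩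
    refine ⟨s + t, fun a ha ↦ ?_⟩
    rw [smul_add, hs a (Ideal.pow_le_pow_right (by lia) ha),
      ht a (Ideal.pow_le_pow_right (by lia) ha), add_zero]
  zero_mem' := ⟨0, by simp⟩
  smul_mem' := by
    rintro c x ⟨s, hs⟩
    exact ⟨s, fun a ha ↦ by rw [smul_comm, hs a ha, smul_zero]⟩

lemma map_mem_gam {M N : Type} [AddCommGroup M] [Module R M] [AddCommGroup N] [Module R N]
    (f : M →ₗ[R] N) {x : M} (hx : x ∈ Gam I M) : f x ∈ Gam I N := by
  obtain ⟨s, hs⟩ := hx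
  exact ⟨s, fun a ha ↦ by rw [← map_smul, hs a ha, map_zero]⟩

lemma mem_gam_of_map {M N : Type} [AddCommGroup M] [Module R M] [AddCommGroup N] [Module R N]
    (f : M →ₗ[R] N) (hf : Function.Injective f) {x : M} (hx : f x ∈ Gam I N) : x ∈ Gam I M := by
  obtain ⟨s, hs⟩ := hx
  exact ⟨s, fun a ha ↦ hf (by rw [map_smul, hs a ha, map_zero])⟩

lemma gam_mono {J : Ideal R} (h : J ≤ I) (M : Type) [AddCommGroup M] [Module R M] :
    Gam I M ≤ Gam J M :=
  fun _ ⟨s, hs⟩ ↦ ⟨s, fun a ha ↦ hs a (Ideal.pow_right_mono h s ha)⟩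

lemma isTors_iff {X : ModuleCat.{0} R} : IsTors I X ↔ Module.Finite R X ∧ Gam I X = ⊤ := by
  constructor
  · rintro ⟨h, s, hs⟩
    exact ⟨h, eq_top_iff.2 fun x _ ↦ ⟨s, fun a ha ↦ hs a ha x⟩⟩
  · rintro ⟨h, hG⟩
    refine ⟨h, ?_⟩
    obtain ⟨S, hS⟩ := h.fg_top
    have h1 : ∀ x : X, ∃ s : ℕ, ∀ a ∈ I ^ s, a • x = 0 := fun x ↦ by
      have : x ∈ Gam I X := by rw [hG]; trivial
      exact this
    choose e he using h1
    refine ⟨S.sup e, fun a ha x ↦ ?_⟩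
    have hx : x ∈ Submodule.span R (S : Set X) := by rw [hS]; trivial
    induction hx using Submodule.span_induction with
    | mem x hx => exact he x a (Ideal.pow_le_pow_right (Finset.le_sup hx) ha)
    | zero => simp
    | add x y _ _ h1 h2 => rw [smul_add, h1, h2, add_zero]
    | smul c x _ h1 => rw [smul_comm, h1, smul_zero]

lemma isTors_span {M : Type} [AddCommGroup M] [Module R M] (S : Set M) (hfin : S.Finite)
    (hS : S ⊆ Gam I M) : IsTors I (.of R (Submodule.span R S)) := by
  rw [isTors_iff]
  refine ⟨Module.Finite.span_of_finite R hfin, eq_top_iff.2 fun x _ ↦ ?_⟩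
  exact mem_gam_of_map (Submodule.span R S).subtype Subtype.val_injective
    (Submodule.span_le.2 hS x.2)

lemma Van.exists_lift {S : ShortComplex (ModuleCat.{0} R)} (hS : S.ShortExact)
    (h₁ : Van I 1 S.X₁) (z : S.X₃) (hz : z ∈ Gam I S.X₃) :
    ∃ y ∈ Gam I S.X₂, S.g.hom y = z := by
  let X : ModuleCat.{0} R := .of R (Submodule.span R {z})
  have hX : IsTors I X := isTors_span _ (Set.finite_singleton z) (by simpa using hz)
  let ι : X ⟶ S.X₃ := ModuleCat.ofHom (Submodule.span R {z}).subtype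
  obtain ⟨X', p, hX', hp, h⟩ := h₁ X hX ((Abelian.Ext.mk₀ ι).comp hS.extClass (zero_add 1))
  rw [Abelian.Ext.mk₀_comp_mk₀_assoc] at h
  obtain ⟨η, hη⟩ := Abelian.Ext.covariant_sequence_exact₃ _ hS _ (zero_add 1) h
  obtain ⟨l, rfl⟩ := (Abelian.Ext.mk₀_bijective _ _).2 η
  rw [Abelian.Ext.mk₀_comp_mk₀] at hη
  have hl := (Abelian.Ext.mk₀_bijective _ _).1 hη
  obtain ⟨x, hx⟩ := hp ⟨z, Submodule.mem_span_singleton_self z⟩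
  refine ⟨l.hom x, map_mem_gam _ ?_, ?_⟩
  · rw [(isTors_iff.1 hX').2]; trivial
  · have := congrArg (fun f ↦ f.hom x) hl
    simp only [ModuleCat.hom_comp, LinearMap.comp_apply] at this
    rw [this]
    change ι.hom (p x) = z
    rw [hx]; rfl

lemma Van.one_of_lift [IsNoetherianRing R] {S : ShortComplex (ModuleCat.{0} R)} (hS : S.ShortExact)
    (h₂ : Van I 1 S.X₂) (H : ∀ z ∈ Gam I S.X₃, ∃ y ∈ Gam I S.X₂, S.g.hom y = z) :
    Van I 1 S.X₁ := by
  intro X hX ξ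
  obtain ⟨X₁, p, hX₁, hp, h⟩ := h₂ X hX (ξ.comp (.mk₀ S.f) (add_zero _))
  rw [← Abelian.Ext.comp_assoc_of_third_deg_zero] at h
  obtain ⟨η, hη⟩ := Abelian.Ext.covariant_sequence_exact₁ _ hS _ h (zero_add 1)
  obtain ⟨φ, rfl⟩ := (Abelian.Ext.mk₀_bijective _ _).2 η
  have hfin := hX₁.finite
  obtain ⟨T, hT⟩ := hfin.fg_top
  have h1 : ∀ x : X₁, ∃ y ∈ Gam I S.X₂, S.g.hom y = φ.hom x := fun x ↦
    H _ (map_mem_gam _ (by rw [(isTors_iff.1 hX₁).2]; trivial))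
  choose e he he' using h1
  let W : Set (X₁ × S.X₂) := (fun x ↦ (x, e x)) '' T
  let Y : ModuleCat.{0} R := .of R (Submodule.span R W)
  have hY : IsTors I Y := by
    refine isTors_span _ (T.finite_toSet.image _) ?_
    rintro _ ⟨x, -, rfl⟩
    have hx : x ∈ Gam I X₁ := by rw [(isTors_iff.1 hX₁).2]; trivial
    have := (Gam I (X₁ × S.X₂)).add_mem (map_mem_gam (LinearMap.inl R X₁ S.X₂) hx)
      (map_mem_gam (LinearMap.inr R X₁ S.X₂) (he x))
    simpa using this
  let q : Y ⟶ X₁ := ModuleCat.ofHom (LinearMap.fst R _ _ ∘ₗ (Submodule.span R W).subtype)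
  let r : Y ⟶ S.X₂ := ModuleCat.ofHom (LinearMap.snd R _ _ ∘ₗ (Submodule.span R W).subtype)
  have hqr : q ≫ φ = r ≫ S.g := by
    ext ⟨x, hx⟩
    change φ.hom x.1 = S.g.hom x.2
    induction hx using Submodule.span_induction with
    | mem x hx => obtain ⟨x, -, rfl⟩ := hx; exact (he' x).symm
    | zero => simp
    | add x y _ _ h1 h2 => simp only [Prod.fst_add, Prod.snd_add, map_add, h1, h2]
    | smul c x _ h1 => simp only [Prod.smul_fst, Prod.smul_snd, map_smul, h1]
  have hq : Function.Surjective q := by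
    have : LinearMap.range q.hom = ⊤ := by
      rw [eq_top_iff, ← hT, Submodule.span_le]
      intro x hx
      exact ⟨⟨(x, e x), Submodule.subset_span ⟨x, hx, rfl⟩⟩, rfl⟩
    exact LinearMap.range_eq_top.1 this
  refine ⟨Y, q ≫ p, hY, by simpa using hp.comp hq, ?_⟩
  rw [← Abelian.Ext.mk₀_comp_mk₀, Abelian.Ext.comp_assoc_of_second_deg_zero, ← hη,
    Abelian.Ext.mk₀_comp_mk₀_assoc, hqr, ← Abelian.Ext.mk₀_comp_mk₀_assoc, hS.comp_extClass,
    Abelian.Ext.comp_zero]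

end Basic

end FV

namespace FV

section InjMod

variable {R : Type} [CommRing R] {I J : Ideal R}

lemma injective_extend {E X Y : Type} [AddCommGroup E] [Module R E] [Module.Injective R E]
    [AddCommGroup X] [Module R X] [AddCommGroup Y] [Module R Y] (φ : X →ₗ[R] Y) (ψ : X →ₗ[R] E)
    (h : LinearMap.ker φ ≤ LinearMap.ker ψ) : ∃ g : Y →ₗ[R] E, g ∘ₗ φ = ψ := by
  obtain ⟨g, hg⟩ := Module.Injective.out (LinearMap.range φ).subtype Subtype.val_injective
    (((LinearMap.ker φ).liftQ ψ h) ∘ₗ φ.quotKerEquivRange.symm.toLinearMap)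
  refine ⟨g, LinearMap.ext fun x ↦ ?_⟩
  have := hg ⟨φ x, x, rfl⟩
  simp only [Submodule.subtype_apply] at this
  rw [LinearMap.comp_apply, this]
  have h2 : φ.quotKerEquivRange.symm ⟨φ x, x, rfl⟩ = Submodule.Quotient.mk x := by
    rw [LinearEquiv.symm_apply_eq]; rfl
  simp [h2]

lemma exists_pow_inf_pow_le [IsNoetherianRing R] (I J : Ideal R) (s : ℕ) :
    ∃ p, I ^ p ⊓ J ^ s ≤ I ^ s * J ^ s := by
  obtain ⟨k, hk⟩ := Ideal.exists_pow_inf_eq_pow_smul (M := R) I (J ^ s)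
  refine ⟨k + s, ?_⟩
  have := hk (k + s) (by lia)
  simp only [smul_eq_mul, Ideal.mul_top] at this
  rw [this, Nat.add_sub_cancel_left]
  exact Ideal.mul_mono_right inf_le_right

lemma gam_inf_le [IsNoetherianRing R] (E : Type) [AddCommGroup E] [Module R E]
    [Module.Injective R E] : Gam (I ⊓ J) E ≤ Gam I E ⊔ Gam J E := by
  rintro x ⟨s, hs⟩
  obtain ⟨p, hp⟩ := exists_pow_inf_pow_le I J (s * 2)
  let φ : R →ₗ[R] (R ⧸ I ^ p) × (R ⧸ J ^ (s * 2)) :=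
    (Submodule.mkQ (I ^ p)).prod (Submodule.mkQ (J ^ (s * 2)))
  obtain ⟨g, hg⟩ := injective_extend φ (LinearMap.toSpanSingleton R E x) (by
    intro a ha
    have h1 : a ∈ I ^ p ∧ a ∈ J ^ (s * 2) := by
      simpa [φ, Submodule.Quotient.mk_eq_zero] using ha
    refine hs a ?_
    have h2 : I * J ≤ I ⊓ J := Ideal.mul_le_inf
    have h3 := hp (Submodule.mem_inf.2 h1)
    rw [← mul_pow] at h3
    exact Ideal.pow_le_pow_right (by lia) (Ideal.pow_right_mono h2 _ h3))
  have hx : x = g (Submodule.Quotient.mk 1, 0) + g (0, Submodule.Quotient.mk 1) := by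
    rw [← map_add]
    have := LinearMap.congr_fun hg 1
    simp only [LinearMap.comp_apply, LinearMap.toSpanSingleton_apply, one_smul] at this
    rw [← this]
    simp [φ]
  rw [hx]
  refine Submodule.add_mem_sup ⟨p, fun a ha ↦ ?_⟩ ⟨s * 2, fun a ha ↦ ?_⟩
  · rw [← map_smul, Prod.smul_mk, smul_zero, ← Submodule.Quotient.mk_smul, smul_eq_mul, mul_one,
      (Submodule.Quotient.mk_eq_zero _).2 ha]
    exact map_zero g
  · rw [← map_smul, Prod.smul_mk, smul_zero, ← Submodule.Quotient.mk_smul, smul_eq_mul, mul_one,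
      (Submodule.Quotient.mk_eq_zero _).2 ha]
    exact map_zero g

lemma exists_colon_stable [IsNoetherianRing R] (I : Ideal R) (f : R) :
    ∃ k : ℕ, ∀ s r, f ^ (k + s) * r ∈ I → f ^ k * r ∈ I := by
  let c : ℕ →o Ideal R :=
    { toFun := fun k ↦ Submodule.comap (LinearMap.mulLeft R (f ^ k)) I
      monotone' := by
        intro a b hab r hr
        simp only [Submodule.mem_comap, LinearMap.mulLeft_apply] at hr ⊢
        obtain ⟨d, rfl⟩ := Nat.exists_eq_add_of_le hab
        rw [pow_add, mul_comm (f ^ a), mul_assoc]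
        exact I.mul_mem_left _ hr }
  obtain ⟨k, hk⟩ := monotone_stabilizes_iff_noetherian.2 (inferInstanceAs (IsNoetherian R R)) c
  refine ⟨k, fun s r h ↦ ?_⟩
  have : r ∈ c (k + s) := h
  rw [← hk (k + s) (by lia)] at this
  exact this

lemma exists_divide [IsNoetherianRing R] (E : Type) [AddCommGroup E] [Module R E]
    [Module.Injective R E] {z : E} (hz : z ∈ Gam I E) (f : R) (s : ℕ) :
    ∃ w ∈ Gam I E, ∃ k, f ^ k • (z - f ^ s • w) = 0 := by
  obtain ⟨p, hp⟩ := hz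
  obtain ⟨k, hk⟩ := exists_colon_stable (I ^ p) f
  obtain ⟨g, hg⟩ := injective_extend (Submodule.mkQ (I ^ p) ∘ₗ LinearMap.mulLeft R (f ^ (k + s)))
    (LinearMap.toSpanSingleton R E z ∘ₗ LinearMap.mulLeft R (f ^ k)) (by
      intro a ha
      have h1 : f ^ (k + s) * a ∈ I ^ p := (Submodule.Quotient.mk_eq_zero _).1 ha
      exact hp _ (hk _ _ h1))
  refine ⟨g (Submodule.Quotient.mk 1), ⟨p, fun a ha ↦ ?_⟩, k, ?_⟩
  · rw [← map_smul, ← Submodule.Quotient.mk_smul, smul_eq_mul, mul_one,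
      (Submodule.Quotient.mk_eq_zero _).2 ha]
    exact map_zero g
  · have := LinearMap.congr_fun hg 1
    simp only [LinearMap.comp_apply, LinearMap.toSpanSingleton_apply, LinearMap.mulLeft_apply,
      mul_one, Submodule.mkQ_apply] at this
    rw [smul_sub, smul_smul, ← pow_add, ← map_smul, ← Submodule.Quotient.mk_smul, smul_eq_mul,
      mul_one, this, sub_self]

end InjMod

section Cosyz

variable {R : Type} [CommRing R] {I J : Ideal R}

/-- An embedding into an injective module together with its cokernel. -/
noncomputable def cosyz (M : ModuleCat.{0} R) : ShortComplex (ModuleCat.{0} R) :=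
  ShortComplex.mk (Injective.ι M) (Limits.cokernel.π (Injective.ι M)) (by simp)

lemma cosyz_shortExact (M : ModuleCat.{0} R) : (cosyz M).ShortExact where
  exact := ShortComplex.exact_cokernel _
  mono_f := inferInstanceAs (Mono (Injective.ι M))
  epi_g := inferInstanceAs (Epi (Limits.cokernel.π (Injective.ι M)))

instance (M : ModuleCat.{0} R) : Injective (cosyz M).X₂ :=
  inferInstanceAs (Injective (Injective.under M))

instance (M : ModuleCat.{0} R) : Module.Injective R (cosyz M).X₂ :=
  (Module.injective_iff_injective_object R _).2 (inferInstanceAs (Injective (cosyz M).X₂))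

lemma van_add_two_iff (M : ModuleCat.{0} R) (j : ℕ) :
    Van I (j + 2) M ↔ Van I (j + 1) (cosyz M).X₃ :=
  Van.succ_iff (cosyz_shortExact M) (Van.of_injective _)

lemma van_one_iff [IsNoetherianRing R] (M : ModuleCat.{0} R) :
    Van I 1 M ↔ ∀ z ∈ Gam I (cosyz M).X₃, ∃ y ∈ Gam I (cosyz M).X₂, (cosyz M).g.hom y = z :=
  ⟨fun h ↦ h.exists_lift (cosyz_shortExact M),
    Van.one_of_lift (cosyz_shortExact M) (Van.of_injective _ 0)⟩

lemma exists_of_g_eq_zero {S : ShortComplex (ModuleCat.{0} R)} (hS : S.ShortExact) {y : S.X₂}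
    (hy : S.g.hom y = 0) : ∃ x, S.f.hom x = y :=
  (ShortComplex.ShortExact.moduleCat_exact_iff_function_exact S).1 hS.exact y |>.1 hy

lemma van_inf_one [IsNoetherianRing R] {M : ModuleCat.{0} R} (hI : Van I 1 M) (hJ : Van J 1 M)
    (hIJ : Van (I ⊔ J) 2 M) : Van (I ⊓ J) 1 M := by
  rw [van_one_iff]
  rw [van_add_two_iff M 0, van_one_iff] at hIJ
  set N := (cosyz M).X₃
  have hS := cosyz_shortExact N
  have hinj : Function.Injective (cosyz N).f.hom := hS.moduleCat_injective_f
  have key : ∀ K L : Ideal R, ∀ w ∈ Gam K (cosyz N).X₂, ∀ c ∈ Gam L (cosyz N).X₂,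
    K ≤ L → Van K 1 M → (cosyz N).g.hom w = (cosyz N).g.hom c →
    ∃ y ∈ Gam K (cosyz M).X₂, (cosyz N).f.hom ((cosyz M).g.hom y) = w - c := by
    intro K L w hw c hc hKL hK h
    obtain ⟨v, hv⟩ := exists_of_g_eq_zero hS (y := w - c) (by rw [map_sub, h, sub_self])
    obtain ⟨y, hy, hy'⟩ := (van_one_iff M).1 hK v
      (mem_gam_of_map (cosyz N).f.hom hinj (by
        rw [hv]; exact sub_mem hw (gam_mono hKL _ hc)))
    exact ⟨y, hy, by rw [hy', hv]⟩
  intro z hz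
  obtain ⟨a, ha, b, hb, hab⟩ := Submodule.mem_sup.1
    (gam_inf_le _ (map_mem_gam (cosyz N).f.hom hz))
  have h0 : (cosyz N).g.hom a = - (cosyz N).g.hom b := by
    rw [eq_neg_iff_add_eq_zero, ← map_add, hab]
    exact (cosyz N).moduleCat_zero_apply z
  have hga : (cosyz N).g.hom a ∈ Gam (I ⊔ J) (cosyz N).X₃ := by
    obtain ⟨s, hs⟩ := map_mem_gam (cosyz N).g.hom ha
    obtain ⟨t, ht⟩ : (cosyz N).g.hom a ∈ Gam J _ := by
      rw [h0]; exact neg_mem (map_mem_gam (cosyz N).g.hom hb)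
    refine ⟨s + t, fun r hr ↦ ?_⟩
    have := Ideal.sup_pow_add_le_pow_sup_pow (I := I) (J := J) (n := s) (m := t) hr
    obtain ⟨u, hu, v, hv, rfl⟩ := Submodule.mem_sup.1 this
    rw [add_smul, hs u hu, ht v hv, add_zero]
  obtain ⟨c, hc, hc'⟩ := hIJ _ hga
  obtain ⟨y₁, hy₁, h₁⟩ := key I _ a ha c hc le_sup_left hI hc'.symm
  obtain ⟨y₂, hy₂, h₂⟩ := key J _ b hb (-c) (neg_mem hc) le_sup_right hJ
    (by rw [map_neg, hc', h0, neg_neg])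
  refine ⟨y₁ + y₂, add_mem (gam_mono inf_le_left _ hy₁) (gam_mono inf_le_right _ hy₂),
    hinj ?_⟩
  refine (congrArg _ (map_add _ _ _)).trans ((map_add (cosyz N).f.hom _ _).trans ?_)
  rw [← hab, h₁, h₂]
  abel

lemma van_inf [IsNoetherianRing R] {M : ModuleCat.{0} R} {j : ℕ} (hI : Van I (j + 1) M)
    (hJ : Van J (j + 1) M) (hIJ : Van (I ⊔ J) (j + 2) M) : Van (I ⊓ J) (j + 1) M := by
  induction j generalizing M with
  | zero => exact van_inf_one hI hJ hIJ
  | succ j ih =>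
    rw [van_add_two_iff] at *
    exact ih hI hJ hIJ

lemma van_sup_span_two [IsNoetherianRing R] {M : ModuleCat.{0} R} (f : R) (h1 : Van I 1 M)
    (h2 : Van I 2 M) : Van (I ⊔ Ideal.span {f}) 2 M := by
  rw [van_add_two_iff M 0, van_one_iff] at h2 ⊢
  set N := (cosyz M).X₃
  have hS := cosyz_shortExact N
  have hinj : Function.Injective (cosyz N).f.hom := hS.moduleCat_injective_f
  intro x hx
  obtain ⟨y, hy, hy'⟩ := h2 x (gam_mono le_sup_left _ hx)
  obtain ⟨s, hs⟩ := hx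
  have hfs : f ^ s • x = 0 := hs _ (Ideal.pow_right_mono le_sup_right s
    (Ideal.pow_mem_pow (Ideal.mem_span_singleton_self f) s))
  obtain ⟨v, hv⟩ := exists_of_g_eq_zero hS (y := f ^ s • y) (by rw [map_smul, hy', hfs])
  obtain ⟨z, hz, hz'⟩ := (van_one_iff M).1 h1 v
    (mem_gam_of_map (cosyz N).f.hom hinj (by rw [hv]; exact Submodule.smul_mem _ _ hy))
  obtain ⟨w, hw, k, hk⟩ := exists_divide _ hz f s
  let d : (cosyz M).X₂ →ₗ[R] (cosyz N).X₂ := (cosyz N).f.hom ∘ₗ (cosyz M).g.hom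
  have hd : ∀ u, (cosyz N).g.hom (d u) = 0 := fun u ↦ (cosyz N).moduleCat_zero_apply _
  refine ⟨y - d w, ?_, by rw [map_sub, hd, sub_zero, hy']⟩
  have hI : y - d w ∈ Gam I (cosyz N).X₂ := sub_mem hy (map_mem_gam d hw)
  have hf : f ^ (k + s) • (y - d w) = 0 := by
    rw [pow_add, mul_smul, smul_sub (f ^ s), ← hv, ← hz']
    change f ^ k • (d z - f ^ s • d w) = 0
    rw [← map_smul, ← map_sub, ← map_smul, hk, map_zero]
  obtain ⟨t, ht⟩ := hI
  refine ⟨t + (k + s), fun r hr ↦ ?_⟩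
  obtain ⟨u, hu, v, hv, rfl⟩ := Submodule.mem_sup.1
    (Ideal.sup_pow_add_le_pow_sup_pow (I := I) (J := Ideal.span {f}) hr)
  rw [Ideal.span_singleton_pow, Ideal.mem_span_singleton'] at hv
  obtain ⟨b, rfl⟩ := hv
  rw [add_smul, ht u hu, mul_smul, hf, smul_zero, add_zero]

lemma van_sup_span [IsNoetherianRing R] {M : ModuleCat.{0} R} (f : R) {j : ℕ}
    (h1 : Van I (j + 1) M) (h2 : Van I (j + 2) M) : Van (I ⊔ Ideal.span {f}) (j + 2) M := by
  induction j generalizing M with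
  | zero => exact van_sup_span_two f h1 h2
  | succ j ih =>
    rw [van_add_two_iff] at *
    exact ih h1 h2

lemma van_bot [IsNoetherianRing R] (M : ModuleCat.{0} R) (j : ℕ) :
    Van (⊥ : Ideal R) (j + 1) M := by
  induction j generalizing M with
  | zero =>
    rw [van_one_iff]
    intro z _
    obtain ⟨y, hy⟩ := (cosyz_shortExact M).moduleCat_surjective_g z
    refine ⟨y, ⟨1, fun a ha ↦ ?_⟩, hy⟩
    rw [pow_one, Ideal.mem_bot] at ha
    rw [ha, zero_smul]
  | succ j ih => rw [van_add_two_iff]; exact ih _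

lemma van_span_finset [IsNoetherianRing R] (T : Finset R) (M : ModuleCat.{0} R) (j : ℕ)
    (hj : T.card < j) : Van (Ideal.span (T : Set R)) j M := by
  classical
  induction T using Finset.induction_on generalizing j with
  | empty =>
    obtain ⟨j, rfl⟩ := Nat.exists_eq_add_of_lt hj
    simpa using van_bot M j
  | insert f T hf ih =>
    rw [Finset.card_insert_of_notMem hf] at hj
    obtain ⟨j, rfl⟩ : ∃ i, j = i + 2 := ⟨j - 2, by lia⟩
    rw [Finset.coe_insert, Ideal.span_insert, sup_comm]
    exact van_sup_span f (ih _ (by lia)) (ih _ (by lia))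

end Cosyz

end FV

namespace FV

section BaseChange

variable {R : Type} [CommRing R] {I : Ideal R}

lemma moduleInjective_of_equiv {E E' : Type} [AddCommGroup E] [Module R E] [AddCommGroup E']
    [Module R E'] [Module.Injective R E] (e : E ≃ₗ[R] E') : Module.Injective R E' :=
  ⟨fun X Y _ _ _ _ f hf g ↦ by
    obtain ⟨h, hh⟩ := Module.Injective.out f hf (e.symm.toLinearMap ∘ₗ g)
    exact ⟨e.toLinearMap ∘ₗ h, fun x ↦ by simp [hh]⟩⟩

lemma van_hom_injective [IsNoetherianRing R] (E : Type) [AddCommGroup E] [Module R E]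
    [Module.Injective R E] (j : ℕ) (N : Type) [AddCommGroup N] [Module R N] [Module.Finite R N] :
    Van I (j + 1) (.of R (N →ₗ[R] E)) := by
  induction j using Nat.strong_induction_on generalizing N with | _ j ih =>
  obtain ⟨m, π, hπ⟩ := Module.Finite.exists_fin' R N
  let ι := (LinearMap.ker π).subtype
  have hinj : Module.Injective R ((Fin m → R) →ₗ[R] E) :=
    moduleInjective_of_equiv (Module.piEquiv (Fin m) R E)
  have hinj' : Injective (ModuleCat.of R ((Fin m → R) →ₗ[R] E)) :=
    (Module.injective_iff_injective_object R _).1 hinj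
  let S : ShortComplex (ModuleCat.{0} R) := ModuleCat.shortComplexOfCompEqZero
    (LinearMap.lcomp R E π) (LinearMap.lcomp R E ι) (by
      ext φ x
      simp [ι])
  have hS : S.ShortExact := by
    refine ModuleCat.shortComplex_shortExact S (fun φ ↦ ⟨fun h ↦ ?_, ?_⟩) ?_ ?_
    · obtain ⟨g, hg⟩ := injective_extend π φ (fun x hx ↦ LinearMap.congr_fun h ⟨x, hx⟩)
      exact ⟨g, hg⟩
    · rintro ⟨g, rfl⟩
      exact S.moduleCat_zero_apply g
    · intro g g' h
      refine LinearMap.ext fun x ↦ ?_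
      obtain ⟨x, rfl⟩ := hπ x
      exact LinearMap.congr_fun h x
    · intro φ
      obtain ⟨g, hg⟩ := injective_extend ι φ (by simp [ι])
      exact ⟨g, hg⟩
  have hinjS : ∀ j, Van I (j + 1) S.X₂ := fun j ↦ Van.of_injective (.of R _) j
  rcases j with - | j
  · refine Van.one_of_lift hS (hinjS 0) ?_
    intro φ hφ
    change (LinearMap.ker π →ₗ[R] E) at φ
    obtain ⟨s, hs⟩ := hφ
    obtain ⟨k, hk⟩ := Ideal.exists_pow_inf_eq_pow_smul I (LinearMap.ker π)
    have hk' := hk (k + s) (by lia)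
    rw [Nat.add_sub_cancel_left] at hk'
    obtain ⟨g, hg⟩ := injective_extend
      (Submodule.mkQ (I ^ (k + s) • (⊤ : Submodule R (Fin m → R))) ∘ₗ ι) φ (by
        rintro ⟨x, hx⟩ hx'
        have h1 : x ∈ I ^ (k + s) • (⊤ : Submodule R (Fin m → R)) :=
          (Submodule.Quotient.mk_eq_zero _).1 hx'
        have h2 : x ∈ I ^ s • LinearMap.ker π := by
          have : x ∈ I ^ s • (I ^ k • (⊤ : Submodule R (Fin m → R)) ⊓ LinearMap.ker π) := by
            rw [← hk']; exact ⟨h1, hx⟩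
          exact Submodule.smul_mono le_rfl inf_le_right this
        have h3 : (⟨x, hx⟩ : LinearMap.ker π) ∈ I ^ s • (⊤ : Submodule R (LinearMap.ker π)) :=
          (Submodule.mem_smul_top_iff _ _ _).2 h2
        refine Submodule.smul_induction_on h3 (fun r hr n _ ↦ ?_) (fun x y hx hy ↦ ?_)
        · rw [LinearMap.mem_ker, map_smul]
          exact LinearMap.congr_fun (hs r hr) n
        · exact add_mem hx hy)
    refine ⟨g ∘ₗ Submodule.mkQ _, ⟨k + s, fun a ha ↦ ?_⟩, hg⟩
    refine LinearMap.ext fun x ↦ ?_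
    change a • g (Submodule.mkQ _ x) = 0
    rw [← map_smul, ← map_smul, Submodule.mkQ_apply,
      (Submodule.Quotient.mk_eq_zero _).2 (Submodule.smul_mem_smul ha Submodule.mem_top), map_zero]
  · exact (Van.succ_iff hS hinjS).2 (ih j (by lia) (LinearMap.ker π))

lemma mem_gam_restrictScalars {R' : Type} [CommRing R'] (f : R →+* R') (M : ModuleCat.{0} R')
    (x : (ModuleCat.restrictScalars f).obj M) :
    x ∈ Gam I ((ModuleCat.restrictScalars f).obj M) ↔ (show M from x) ∈ Gam (I.map f) M := by
  constructor
  · rintro ⟨s, hs⟩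
    refine ⟨s, fun a ha ↦ ?_⟩
    rw [← Ideal.map_pow] at ha
    induction ha using Submodule.span_induction with
    | mem a ha => obtain ⟨b, hb, rfl⟩ := ha; exact hs b hb
    | zero => rw [zero_smul]
    | add a b _ _ h1 h2 => rw [add_smul, h1, h2, add_zero]
    | smul c a _ h => rw [smul_eq_mul, mul_smul, h, smul_zero]
  · rintro ⟨s, hs⟩
    refine ⟨s, fun a ha ↦ ?_⟩
    exact hs (f a) (by rw [← Ideal.map_pow]; exact Ideal.mem_map_of_mem f ha)

lemma van_restrictScalars_coextendScalars [IsNoetherianRing R] {R' : Type} [CommRing R']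
    (f : R →+* R') (hf : f.Finite) (E : ModuleCat.{0} R) [Injective E] (j : ℕ) :
    Van I (j + 1) ((ModuleCat.restrictScalars f).obj ((ModuleCat.coextendScalars f).obj E)) := by
  have : Module.Injective R E := (Module.injective_iff_injective_object R _).2 ‹_›
  have : Module.Finite R ((ModuleCat.restrictScalars f).obj (ModuleCat.of R' R')) := hf
  let e : (((ModuleCat.restrictScalars f).obj (ModuleCat.of R' R')) →ₗ[R] E) ≃ₗ[R]
      (ModuleCat.restrictScalars f).obj ((ModuleCat.coextendScalars f).obj E) :=
    { toFun := fun g ↦ g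
      invFun := fun g ↦ g
      left_inv := fun _ ↦ rfl
      right_inv := fun _ ↦ rfl
      map_add' := fun _ _ ↦ rfl
      map_smul' := fun r g ↦ by
        refine LinearMap.ext fun x ↦ ?_
        have h : (r • x : (ModuleCat.restrictScalars f).obj (ModuleCat.of R' R')) =
            (show R' from x) * f r := mul_comm (f r) _
        exact (map_smul g r x).symm.trans (congrArg g h) }
  exact Van.of_iso e.toModuleIso (van_hom_injective E j
    ((ModuleCat.restrictScalars f).obj (ModuleCat.of R' R')))

/-- Independence of the base ring, for finite ring maps. -/
lemma van_restrictScalars [IsNoetherianRing R] {R' : Type} [CommRing R']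
    (f : R →+* R') (hf : f.Finite) (M : ModuleCat.{0} R') (j : ℕ)
    (h : Van (I.map f) (j + 1) M) : Van I (j + 1) ((ModuleCat.restrictScalars f).obj M) := by
  induction j using Nat.strong_induction_on generalizing M with | _ j ih =>
  have adj := ModuleCat.restrictCoextendScalarsAdj.{0} f
  let E₀ := Injective.under ((ModuleCat.restrictScalars f).obj M)
  let E := (ModuleCat.coextendScalars f).obj E₀
  have : Injective E := Injective.injective_of_adjoint adj _
  let g : M ⟶ E := adj.homEquiv _ _ (Injective.ι _)
  have hg : Mono g := by
    refine ⟨fun u v huv ↦ (ModuleCat.restrictScalars f).map_injective ?_⟩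
    rw [← cancel_mono (Injective.ι ((ModuleCat.restrictScalars f).obj M))]
    apply (adj.homEquiv _ _).injective
    rw [adj.homEquiv_naturality_left, adj.homEquiv_naturality_left, huv]
  let S : ShortComplex (ModuleCat.{0} R') := .mk g (Limits.cokernel.π g) (by simp)
  have hS : S.ShortExact :=
    { exact := ShortComplex.exact_cokernel _
      mono_f := hg
      epi_g := inferInstanceAs (Epi (Limits.cokernel.π g)) }
  have hS' := hS.map_of_exact (ModuleCat.restrictScalars f)
  have hE' : ∀ j, Van I (j + 1) (S.map (ModuleCat.restrictScalars f)).X₂ :=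
    fun j ↦ van_restrictScalars_coextendScalars f hf E₀ j
  rcases j with - | j
  · refine Van.one_of_lift hS' (hE' 0) fun z hz ↦ ?_
    obtain ⟨y, hy, rfl⟩ := h.exists_lift hS z ((mem_gam_restrictScalars f S.X₃ z).1 hz)
    exact ⟨y, (mem_gam_restrictScalars f S.X₂ y).2 hy, rfl⟩
  · have h1 := (Van.succ_iff hS (Van.of_injective E)).1 h
    exact (Van.succ_iff hS' hE').2 (ih j (by lia) _ h1)

end BaseChange

end FV

namespace FV

open scoped Pointwise

section Grothendieck

variable {R : Type} [CommRing R] {I : Ideal R}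

instance gam_injective [IsNoetherianRing R] (E : Type) [AddCommGroup E] [Module R E]
    [Module.Injective R E] : Module.Injective R (Gam I E) := by
  apply Module.Baer.injective
  intro 𝔞 g
  have hT : IsTors I (.of R (LinearMap.range g)) := by
    refine isTors_iff.2 ⟨Module.Finite.range g, eq_top_iff.2 ?_⟩
    rintro ⟨x, -⟩ -
    obtain ⟨s, hs⟩ := x.2
    exact ⟨s, fun a ha ↦ Subtype.ext (Subtype.ext (hs a ha))⟩
  obtain ⟨-, s, hs⟩ := hT
  obtain ⟨k, hk⟩ := Ideal.exists_pow_inf_eq_pow_smul (M := R) I 𝔞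
  have hk' := hk (k + s) (by lia)
  rw [Nat.add_sub_cancel_left] at hk'
  obtain ⟨h, hh⟩ := injective_extend ((Submodule.mkQ (I ^ (k + s))) ∘ₗ 𝔞.subtype)
    ((Gam I E).subtype ∘ₗ g) (by
      rintro ⟨x, hx⟩ hx'
      have h1 : x ∈ I ^ (k + s) := (Submodule.Quotient.mk_eq_zero _).1 hx'
      have h2 : x ∈ I ^ s • 𝔞 := by
        have : x ∈ I ^ s • (I ^ k • (⊤ : Submodule R R) ⊓ 𝔞) := by
          rw [← hk']
          refine ⟨?_, hx⟩
          rw [smul_eq_mul, Ideal.mul_top]; exact h1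
        exact Submodule.smul_mono le_rfl inf_le_right this
      have h3 : (⟨x, hx⟩ : 𝔞) ∈ I ^ s • (⊤ : Submodule R 𝔞) :=
        (Submodule.mem_smul_top_iff _ _ _).2 h2
      rw [LinearMap.mem_ker]
      suffices g ⟨x, hx⟩ = 0 by simp [this]
      refine Submodule.smul_induction_on (p := fun z ↦ g z = 0) h3 (fun r hr n _ ↦ ?_)
        (fun x y hx hy ↦ by rw [map_add, hx, hy, add_zero])
      rw [map_smul]
      exact congrArg Subtype.val (hs r hr ⟨g n, n, rfl⟩))
  have hmem : ∀ x, h (Submodule.Quotient.mk x) ∈ Gam I E := fun x ↦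
    ⟨k + s, fun a ha ↦ by
      rw [← map_smul, ← Submodule.Quotient.mk_smul, smul_eq_mul,
        (Submodule.Quotient.mk_eq_zero _).2 (Ideal.mul_mem_right _ _ ha), map_zero]⟩
  refine ⟨LinearMap.codRestrict (Gam I E) (h ∘ₗ Submodule.mkQ _) hmem, fun x hx ↦ ?_⟩
  exact Subtype.ext (LinearMap.congr_fun hh ⟨x, hx⟩)

lemma van_of_gam_eq_top [IsNoetherianRing R] (M : ModuleCat.{0} R) (hM : Gam I M = ⊤) (j : ℕ) :
    Van I (j + 1) M := by
  induction j using Nat.strong_induction_on generalizing M with | _ j ih =>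
  let E := (cosyz M).X₂
  have hM' : ∀ x : M, x ∈ Gam I M := fun x ↦ by rw [hM]; exact Submodule.mem_top
  have hi : Function.Injective (cosyz M).f.hom := (cosyz_shortExact M).moduleCat_injective_f
  let E' : ModuleCat.{0} R := .of R (Gam I E)
  have hE'' : Module.Injective R (Gam I E) := gam_injective (cosyz M).X₂
  have hE' : Injective E' := (Module.injective_iff_injective_object R (Gam I E)).1 hE''
  let ι : M →ₗ[R] Gam I E := LinearMap.codRestrict (Gam I E) (cosyz M).f.hom
    (fun x ↦ map_mem_gam (M := M) (N := E) (cosyz M).f.hom (hM' x))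
  have hι : Function.Injective ι := fun x y h ↦ hi (congrArg Subtype.val h)
  let S : ShortComplex (ModuleCat.{0} R) := ModuleCat.shortComplexOfCompEqZero ι
    (LinearMap.range ι).mkQ (LinearMap.range_mkQ_comp ι)
  have hS : S.ShortExact := ModuleCat.shortComplex_shortExact S
    (LinearMap.exact_map_mkQ_range ι) hι (Submodule.mkQ_surjective _)
  have htop : Gam I E' = ⊤ := by
    refine eq_top_iff.2 fun x _ ↦ ?_
    obtain ⟨s, hs⟩ := x.2
    exact ⟨s, fun a ha ↦ Subtype.ext (hs a ha)⟩
  have htop' : Gam I S.X₃ = ⊤ := by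
    refine eq_top_iff.2 fun x _ ↦ ?_
    obtain ⟨y, rfl⟩ := hS.moduleCat_surjective_g x
    exact map_mem_gam (M := E') S.g.hom (by rw [htop]; exact Submodule.mem_top)
  rcases j with - | j
  · refine Van.one_of_lift hS (Van.of_injective E' 0) fun z _ ↦ ?_
    obtain ⟨y, hy⟩ := hS.moduleCat_surjective_g z
    exact ⟨y, by change y ∈ Gam I E'; rw [htop]; exact Submodule.mem_top, hy⟩
  · exact (Van.succ_iff hS (Van.of_injective E')).2 (ih j (by lia) _ htop')

lemma van_of_subsingleton (M : ModuleCat.{0} R) [Subsingleton M] (j : ℕ) : Van I j M := by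
  intro X hX ξ
  refine ⟨X, 𝟙 X, hX, Function.surjective_id, ?_⟩
  have h : ξ = ξ.comp (.mk₀ (𝟙 M)) (add_zero j) := by simp
  have h0 : 𝟙 M = 0 := by ext x; exact Subsingleton.elim _ _
  rw [h, h0, Abelian.Ext.mk₀_zero, Abelian.Ext.comp_zero, Abelian.Ext.comp_zero]

lemma van_of_isSMulRegular (M : ModuleCat.{0} R) {f : R} (hf : f ∈ I) (hreg : IsSMulRegular M f)
    (j : ℕ) (h : ∀ s : ℕ, Van I j (.of R (QuotSMulTop (f ^ s) M))) : Van I (j + 1) M := by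
  intro X hX ξ
  obtain ⟨-, s, hs⟩ := id hX
  let S : ShortComplex (ModuleCat.{0} R) := ModuleCat.shortComplexOfCompEqZero
    (LinearMap.lsmul R M (f ^ s)) (Submodule.mkQ (f ^ s • (⊤ : Submodule R M))) (by
      ext x
      exact (Submodule.Quotient.mk_eq_zero _).2 (Submodule.smul_mem_pointwise_smul _ _ _ Submodule.mem_top))
  have hS : S.ShortExact := by
    refine ModuleCat.shortComplex_shortExact S (fun x ↦ ?_) (hreg.pow s)
      (Submodule.mkQ_surjective _)
    refine Iff.trans (Submodule.Quotient.mk_eq_zero _) ?_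
    rw [Submodule.mem_smul_pointwise_iff_exists]
    exact ⟨fun ⟨y, _, hy⟩ ↦ ⟨y, hy⟩, fun ⟨y, hy⟩ ↦ ⟨y, Submodule.mem_top, hy⟩⟩
  have hf1 : S.f = f ^ s • 𝟙 M := rfl
  have hX0 : f ^ s • 𝟙 X = 0 := by
    ext x; exact hs _ (Ideal.pow_mem_pow hf s) x
  have h0 : ξ.comp (.mk₀ S.f) (add_zero _) = 0 := by
    rw [hf1, Abelian.Ext.mk₀_smul, Abelian.Ext.comp_smul, Abelian.Ext.comp_mk₀_id,
      ← Abelian.Ext.mk₀_id_comp ξ, ← Abelian.Ext.smul_comp, ← Abelian.Ext.mk₀_smul, hX0,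
      Abelian.Ext.mk₀_zero, Abelian.Ext.zero_comp]
  obtain ⟨η, rfl⟩ := Abelian.Ext.covariant_sequence_exact₁ _ hS ξ h0 rfl
  obtain ⟨X', p, hX', hp, h'⟩ := h s X hX η
  exact ⟨X', p, hX', hp, by
    rw [← Abelian.Ext.comp_assoc _ _ _ (zero_add j) rfl (by lia), h', Abelian.Ext.zero_comp]⟩

/-- Grothendieck vanishing. -/
lemma van_of_supportDim_lt [IsNoetherianRing R] (j : ℕ) (M : Type) [AddCommGroup M] [Module R M]
    [hfin : Module.Finite R M] (h : Module.supportDim R M < j) : Van I j (.of R M) := by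
  induction j generalizing M with
  | zero =>
    have : Subsingleton M := by
      rw [← Module.supportDim_eq_bot_iff_subsingleton R]
      exact WithBot.lt_coe_bot.1 (by simpa using h)
    exact van_of_subsingleton _ _
  | succ j ih =>
    revert h
    induction hfin using IsNoetherianRing.induction_on_isQuotientEquivQuotientPrime R with
    | subsingleton N => intro _; exact van_of_subsingleton _ _
    | quotient N p e =>
      intro h
      by_cases hI : I ≤ p.1
      · refine van_of_gam_eq_top _ (eq_top_iff.2 fun x _ ↦ ⟨1, fun a ha ↦ ?_⟩) j
        refine e.injective ?_
        rw [map_smul, map_zero]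
        obtain ⟨y, hy⟩ := Submodule.mkQ_surjective _ (e x)
        rw [← hy, ← map_smul]
        exact (Submodule.Quotient.mk_eq_zero _).2 (Ideal.mul_mem_right _ _ (hI (by simpa using ha)))
      · obtain ⟨f, hf, hfp⟩ := Set.not_subset.1 hI
        have hreg : ∀ g : R, g ∉ p.1 → IsSMulRegular N g := by
          intro g hg x y hxy
          refine e.injective ?_
          obtain ⟨x', hx'⟩ := Submodule.mkQ_surjective _ (e x)
          obtain ⟨y', hy'⟩ := Submodule.mkQ_surjective _ (e y)
          have h2 : e (g • x) = e (g • y) := congrArg e hxy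
          rw [map_smul, map_smul, ← hx', ← hy', ← map_smul, ← map_smul] at h2
          rw [← hx', ← hy']
          have h3 := (Submodule.Quotient.eq _).1 h2
          rw [← smul_sub, smul_eq_mul] at h3
          exact (Submodule.Quotient.eq _).2 ((p.2.mem_or_mem h3).resolve_left hg)
        refine van_of_isSMulRegular (.of R N) hf (hreg f hfp) j fun s ↦ ?_
        refine ih (QuotSMulTop (f ^ s) N) ?_
        have hp : Module.annihilator R N = p.1 := by
          rw [e.annihilator_eq, Ideal.annihilator_quotient]
        have h5 := Module.supportDim_quotSMulTop_succ_le_of_notMem_minimalPrimes (R := R) (M := N)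
          (x := f ^ s) (by
            rw [hp, Ideal.minimalPrimes_eq_subsingleton_self]
            rintro q rfl hq
            exact hfp (p.2.mem_of_pow_mem _ hq))
        have h6 := h5.trans_lt h
        by_contra h7
        rw [not_lt] at h7
        exact absurd h6 (not_lt.2 (by
          have := add_le_add_left h7 1
          push_cast at this ⊢
          exact this))
    | exact N₁ N₂ N₃ f g hf hg hfg h₁ h₃ =>
      intro h
      let S : ShortComplex (ModuleCat.{0} R) := ModuleCat.shortComplexOfCompEqZero f g
        hfg.linearMap_comp_eq_zero
      have hS : S.ShortExact := ModuleCat.shortComplex_shortExact S hfg hf hg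
      exact Van.of_shortExact₂ hS
        (h₁ ((Module.supportDim_le_of_injective f hf).trans_lt h))
        (h₃ ((Module.supportDim_le_of_surjective g hg).trans_lt h))

end Grothendieck

end FV

namespace FV

section Descent

lemma exists_linearMap_ne_zero (A T : Type) [CommRing A] [IsDomain A] [IsNoetherianRing A]
    [CommRing T] [IsDomain T] [Algebra A T] [FaithfulSMul A T] [Module.Finite A T] :
    ∃ φ : T →ₗ[A] A, φ ≠ 0 := by
  let K := FractionRing A
  let L := FractionRing T
  have : FaithfulSMul A L := FaithfulSMul.trans A T L
  let _ : Algebra K L := FractionRing.liftAlgebra A L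
  obtain ⟨ψ, hψ⟩ := Module.Projective.exists_dual_ne_zero K (one_ne_zero (α := L))
  let g : T →ₗ[A] K := (ψ.restrictScalars A) ∘ₗ (IsScalarTower.toAlgHom A T L).toLinearMap
  have : Module.FinitePresentation A T := Module.finitePresentation_of_finite A T
  obtain ⟨h, s, hs⟩ := Module.FinitePresentation.exists_lift_of_isLocalizedModule
    (nonZeroDivisors A) (Algebra.linearMap A K) g
  refine ⟨h, ?_⟩
  rintro rfl
  have := LinearMap.congr_fun hs 1
  simp only [LinearMap.comp_zero, LinearMap.zero_apply, Submonoid.smul_def, LinearMap.smul_apply,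
    LinearMap.comp_apply, Algebra.smul_def, g] at this
  refine hψ (Eq.trans (by simp) ((mul_eq_zero.1 this.symm).resolve_left ?_))
  simp

variable {R : Type} [CommRing R] {I : Ideal R}

lemma van_of_forall_prime [IsNoetherianRing R] {j : ℕ} (M : Type) [AddCommGroup M] [Module R M]
    [hfin : Module.Finite R M] (h : ∀ p : Ideal R, p.IsPrime → Module.annihilator R M ≤ p →
      Van I j (.of R (R ⧸ p))) : Van I j (.of R M) := by
  revert h
  induction hfin using IsNoetherianRing.induction_on_isQuotientEquivQuotientPrime R with
  | subsingleton N => intro _; exact van_of_subsingleton _ _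
  | quotient N p e =>
    intro h
    refine Van.of_iso e.symm.toModuleIso (h p.1 p.2 ?_)
    rw [e.annihilator_eq, Ideal.annihilator_quotient]
  | exact N₁ N₂ N₃ f g hf hg hfg h₁ h₃ =>
    intro h
    let S : ShortComplex (ModuleCat.{0} R) := ModuleCat.shortComplexOfCompEqZero f g
      hfg.linearMap_comp_eq_zero
    have hS : S.ShortExact := ModuleCat.shortComplex_shortExact S hfg hf hg
    exact Van.of_shortExact₂ hS
      (h₁ fun p hp hp' ↦ h p hp ((f.annihilator_le_of_injective hf).trans hp'))
      (h₃ fun p hp hp' ↦ h p hp ((g.annihilator_le_of_surjective hg).trans hp'))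

lemma van_quotient_of_liesOver [IsNoetherianRing R] {R' : Type} [CommRing R'] [Algebra R R']
    [Module.Finite R R'] (p : Ideal R) [p.IsPrime] (q : Ideal R') [q.IsPrime] [q.LiesOver p]
    {j : ℕ} (hj : ∀ (M : Type) [AddCommGroup M] [Module R M] [Module.Finite R M],
      Van I (j + 1) (.of R M)) (hq : Van I j (.of R (R' ⧸ q)))
    (hp : ∀ p' : Ideal R, p'.IsPrime → p < p' → Van I j (.of R (R ⧸ p'))) :
    Van I j (.of R (R ⧸ p)) := by
  have : Module.Finite (R ⧸ p) (R' ⧸ q) := Module.Finite.of_restrictScalars_finite R _ _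
  obtain ⟨φ₀, hφ₀⟩ := exists_linearMap_ne_zero (R ⧸ p) (R' ⧸ q)
  let φ : (R' ⧸ q) →ₗ[R] (R ⧸ p) := φ₀.restrictScalars R
  let S₁ := LinearMap.shortComplexKer φ.rangeRestrict
  have hS₁ : S₁.ShortExact := LinearMap.shortExact_shortComplexKer φ.surjective_rangeRestrict
  have h₁ : Van I j (.of R (LinearMap.range φ)) := Van.of_shortExact₃ hS₁ (hj _) hq
  let S₂ : ShortComplex (ModuleCat.{0} R) := ModuleCat.shortComplexOfCompEqZero
    (LinearMap.range φ).subtype (LinearMap.range φ).mkQ (by ext x; simp)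
  have hS₂ : S₂.ShortExact := ModuleCat.shortComplex_shortExact S₂
    (LinearMap.exact_subtype_mkQ _) (Submodule.subtype_injective _) (Submodule.mkQ_surjective _)
  refine Van.of_shortExact₂ hS₂ h₁ (van_of_forall_prime _ fun p' hp' hle ↦ hp p' hp' ?_)
  have hle1 : p ≤ p' := le_trans (fun a ha ↦ by
    rw [Module.mem_annihilator]
    intro x
    obtain ⟨y, rfl⟩ := Submodule.mkQ_surjective _ x
    obtain ⟨z, rfl⟩ := Submodule.mkQ_surjective _ y
    rw [← map_smul, ← map_smul, smul_eq_mul]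
    have : p.mkQ (a * z) = 0 := (Submodule.Quotient.mk_eq_zero _).2 (Ideal.mul_mem_right _ _ ha)
    rw [this, map_zero]) hle
  refine lt_of_le_of_ne hle1 ?_
  rintro rfl
  obtain ⟨x, hx⟩ : ∃ x, φ x ≠ 0 := by
    by_contra! h; exact hφ₀ (LinearMap.ext h)
  obtain ⟨a, ha⟩ := Ideal.Quotient.mk_surjective (φ x)
  refine hx ?_
  rw [← ha]
  refine Ideal.Quotient.eq_zero_iff_mem.2 (hle ?_)
  rw [Module.mem_annihilator]
  intro y
  obtain ⟨z, rfl⟩ := Submodule.mkQ_surjective _ y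
  obtain ⟨w, rfl⟩ := Ideal.Quotient.mk_surjective z
  rw [← map_smul]
  refine (Submodule.Quotient.mk_eq_zero _).2 ⟨w • x, ?_⟩
  rw [map_smul, ← ha]
  change Ideal.Quotient.mk p (w * a) = Ideal.Quotient.mk p (a * w)
  rw [mul_comm]

lemma van_descent [IsNoetherianRing R] {R' : Type} [CommRing R'] [Algebra R R']
    [Module.Finite R R'] (hsurj : ∀ p : Ideal R, p.IsPrime → ∃ q : Ideal R', q.IsPrime ∧
      q.LiesOver p) (d N : ℕ) (hN : ∀ j, N ≤ j → ∀ (M : Type) [AddCommGroup M] [Module R M]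
      [Module.Finite R M], Van I j (.of R M))
    (hd : ∀ j, d ≤ j → ∀ q : Ideal R', Van I j (.of R (R' ⧸ q)))
    (j : ℕ) (hj : d ≤ j) (M : Type) [AddCommGroup M] [Module R M]
      [Module.Finite R M] : Van I j (.of R M) := by
  obtain ⟨k, hk⟩ : ∃ k, N ≤ j + k := ⟨N, by lia⟩
  induction k generalizing j M with
  | zero => exact hN j hk M
  | succ k ih =>
    refine van_of_forall_prime _ fun p hp hM ↦ ?_
    clear hM
    induction p using WellFoundedGT.induction with | _ p ihp =>
    obtain ⟨q, hq, hq'⟩ := hsurj p hp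
    exact van_quotient_of_liesOver p q (fun M _ _ _ ↦ ih (j + 1) (by lia) M (by lia)) (hd j hj q)
      (fun p' hp' hlt ↦ ihp p' hlt hp')

end Descent

end FV

namespace FV

open Opposite

section Link

variable {R : Type} [CommRing R]

lemma exists_homologyι_unop (K : ChainComplex (ModuleCat.{0} R)ᵒᵖ ℕ) (n : ℕ)
    (x : (K.homology n).unop) : ∃ y : (K.opcycles n).unop, (K.homologyι n).unop y = x :=
  (ModuleCat.epi_iff_surjective (K.homologyι n).unop).1 inferInstance x

lemma homologyι_unop_eq_zero (K : ChainComplex (ModuleCat.{0} R)ᵒᵖ ℕ) (n : ℕ)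
    (y : (K.opcycles (n + 1)).unop) (w : (K.X n).unop)
    (h : (K.pOpcycles (n + 1)).unop y = (K.d (n + 1) n).unop w) :
    (K.homologyι (n + 1)).unop y = 0 := by
  have hinj : Function.Injective (K.pOpcycles (n + 1)).unop :=
    (ModuleCat.mono_iff_injective _).1 inferInstance
  have hy : y = (K.fromOpcycles (n + 1) n).unop w := hinj (by
    rw [h, ← K.p_fromOpcycles (n + 1) n]; rfl)
  rw [hy]
  have := congrArg (fun f ↦ f.unop w) (K.homologyι_comp_fromOpcycles (n + 1) n)
  exact this

lemma exists_ext_class (X M : ModuleCat.{0} R) (n : ℕ)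
    (x : ((Ext R (ModuleCat.{0} R) (n + 1)).obj (op X)).obj M) :
    ∃ ξ : Abelian.Ext X M (n + 1), ∀ (X' : ModuleCat.{0} R) (f : X' ⟶ X),
      (Abelian.Ext.mk₀ f).comp ξ (zero_add _) = 0 →
        ((Ext R (ModuleCat.{0} R) (n + 1)).map f.op).app M x = 0 := by
  let F : ModuleCat.{0} R ⥤ (ModuleCat.{0} R)ᵒᵖ := ((linearYoneda R (ModuleCat.{0} R)).obj M).rightOp
  let P := projectiveResolution X
  let K := (F.mapHomologicalComplex (ComplexShape.down ℕ)).obj P.complex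
  let e := P.isoLeftDerivedObj F (n + 1)
  obtain ⟨y, hy⟩ := exists_homologyι_unop K (n + 1) (e.inv.unop x)
  let z : P.complex.X (n + 1) ⟶ M := (K.pOpcycles (n + 1)).unop y
  have hz : P.complex.d (n + 2) (n + 1) ≫ z = 0 :=
    congrArg (fun f ↦ f.unop y) (K.d_pOpcycles (n + 2) (n + 1))
  refine ⟨P.extMk z (n + 2) rfl hz, fun X' f hf ↦ ?_⟩
  let P' := projectiveResolution X'
  let K' := (F.mapHomologicalComplex (ComplexShape.down ℕ)).obj P'.complex
  let e' := P'.isoLeftDerivedObj F (n + 1)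
  let φ : ProjectiveResolution.Hom P' P f :=
    ⟨ProjectiveResolution.lift f P' P, ProjectiveResolution.lift_commutes_zero _ _ _⟩
  rw [ProjectiveResolution.mk₀_comp_extMk _ _ _ _ φ,
    ProjectiveResolution.extMk_eq_zero_iff _ _ _ _ _ n rfl] at hf
  obtain ⟨w, hw⟩ := hf
  let ψ : K' ⟶ K := (F.mapHomologicalComplex (ComplexShape.down ℕ)).map φ.hom
  have h1 : (F.leftDerived (n + 1)).map f ≫ e.hom = e'.hom ≫ HomologicalComplex.homologyMap ψ (n + 1) :=
    ProjectiveResolution.isoLeftDerivedObj_hom_naturality f P' P φ.hom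
      φ.hom_f_zero_comp_π_f_zero F (n + 1)
  change ((F.leftDerived (n + 1)).map f).unop x = 0
  have hx : x = (e.hom.unop) ((K.homologyι (n + 1)).unop y) := by
    rw [hy]
    exact (congrArg (fun f ↦ f.unop x) e.hom_inv_id).symm
  rw [hx]
  have h2 := congrArg (fun f ↦ f.unop ((K.homologyι (n + 1)).unop y)) h1
  refine Eq.trans h2 ?_
  have h3 := congrArg (fun f ↦ f.unop y) (HomologicalComplex.homologyι_naturality ψ (n + 1))
  have h4 : (K'.homologyι (n + 1)).unop ((HomologicalComplex.opcyclesMap ψ (n + 1)).unop y) = 0 := by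
    refine homologyι_unop_eq_zero K' n _ w ?_
    have h5 := congrArg (fun f ↦ f.unop y) (HomologicalComplex.p_opcyclesMap ψ (n + 1))
    exact h5.trans hw.symm
  have h6 : (HomologicalComplex.homologyMap ψ (n + 1)).unop ((K.homologyι (n + 1)).unop y) = 0 :=
    h3.trans h4
  exact (congrArg e'.hom.unop h6).trans (map_zero e'.hom.unop.hom)

/-- The effaceability condition implies vanishing of local cohomology. -/
lemma subsingleton_localCohomology [IsNoetherianRing R] {I : Ideal R} (n : ℕ) (M : ModuleCat.{0} R)
    (h : Van I (n + 1) M) : Subsingleton ((localCohomology I (n + 1)).obj M) := by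
  let D := localCohomology.diagram (localCohomology.idealPowersDiagram I) (n + 1)
  have : Limits.HasColimit D := localCohomology.hasColimitDiagram.{0, 0} _ _
  let ev := (evaluation (ModuleCat.{0} R) (ModuleCat.{0} R)).obj M
  let hc : Limits.IsColimit (ev.mapCocone (Limits.colimit.cocone D)) :=
    Limits.isColimitOfPreserves ev (Limits.colimit.isColimit D)
  refine subsingleton_of_forall_eq 0 fun z ↦ ?_
  obtain ⟨t, x, hx⟩ := Limits.Concrete.isColimit_exists_rep _ hc z
  obtain ⟨ξ, hξ⟩ := exists_ext_class (.of R (R ⧸ I ^ t.unop.unop)) M n x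
  obtain ⟨X', p, hX', hp, h0⟩ := h (.of R (R ⧸ I ^ t.unop.unop)) ⟨inferInstance, t.unop.unop, by
    intro a ha x
    obtain ⟨y, rfl⟩ := Ideal.Quotient.mk_surjective x
    exact Ideal.Quotient.eq_zero_iff_mem.2 (Ideal.mul_mem_right _ _ ha)⟩ ξ
  obtain ⟨-, s, hs⟩ := hX'
  obtain ⟨u, hu⟩ := hp (Ideal.Quotient.mk _ 1)
  let m := t.unop.unop + s
  let q : R ⧸ I ^ m →ₗ[R] X' := Submodule.liftQ _ (LinearMap.toSpanSingleton R X' u) (by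
    intro a ha
    exact hs a (Ideal.pow_le_pow_right (by lia) ha) u)
  let i : t ⟶ op (op m) := (homOfLE (show t.unop.unop ≤ m by lia)).op.op
  have hq : (localCohomology.ringModIdeals (localCohomology.idealPowersDiagram I)).map i.unop =
      ModuleCat.ofHom q ≫ p := by
    ext x
    obtain ⟨a, rfl⟩ := Ideal.Quotient.mk_surjective x
    have h1 : p.hom (a • u) = Ideal.Quotient.mk _ (a * 1) := by
      rw [map_smul, hu]; rfl
    rw [mul_one] at h1
    exact h1.symm
  have hz := hξ _ (ModuleCat.ofHom q ≫ p) (by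
    rw [← Abelian.Ext.mk₀_comp_mk₀, Abelian.Ext.comp_assoc_of_second_deg_zero, h0,
      Abelian.Ext.comp_zero])
  rw [← hx, ← (ev.mapCocone (Limits.colimit.cocone D)).w i]
  have h1 : (D ⋙ ev).map i x = 0 := by
    have : (D ⋙ ev).map i = ((Ext R (ModuleCat.{0} R) (n + 1)).map
      (((localCohomology.ringModIdeals (localCohomology.idealPowersDiagram I)).map i.unop).op)).app M :=
      rfl
    rw [this, hq]
    exact hz
  exact (congrArg (((ev.mapCocone (Limits.colimit.cocone D)).ι.app (op (op m))).hom) h1).trans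
    (map_zero _)

end Link

end FV

namespace FV

section Cover

variable {R : Type} [CommRing R]

lemma van_top (M : ModuleCat.{0} R) (j : ℕ) : Van (⊤ : Ideal R) j M := by
  intro X hX ξ
  refine ⟨X, 𝟙 X, hX, Function.surjective_id, ?_⟩
  obtain ⟨-, s, hs⟩ := hX
  have h0 : 𝟙 X = 0 := by
    ext x
    have := hs 1 (by rw [Ideal.top_pow]; trivial) x
    rw [one_smul] at this
    simpa using this
  rw [h0, Abelian.Ext.mk₀_zero, Abelian.Ext.zero_comp]

lemma radical_sup_inf (K A B : Ideal R) :
    (K ⊔ A ⊓ B).radical = ((K ⊔ A) ⊓ (K ⊔ B)).radical := by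
  refine le_antisymm (Ideal.radical_mono (le_inf (sup_le_sup_left inf_le_left _)
    (sup_le_sup_left inf_le_right _))) ?_
  rw [Ideal.radical_inf, Ideal.radical_eq_sInf (K ⊔ A ⊓ B)]
  refine le_sInf fun p ⟨hp, hp'⟩ ↦ ?_
  have h1 : K ≤ p := le_sup_left.trans hp
  rcases hp'.inf_le.1 (le_sup_right.trans hp) with h | h
  · exact inf_le_left.trans (hp'.radical_le_iff.2 (sup_le h1 h))
  · exact inf_le_right.trans (hp'.radical_le_iff.2 (sup_le h1 h))

lemma van_inf_of_cover [IsNoetherianRing R] {ι : Type} (s : Finset ι) (Q : ι → Ideal R)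
    (n c : ℕ) (hQ : ∀ i ∈ s, ∃ T : Finset R, Ideal.span (T : Set R) = Q i ∧ T.card ≤ c)
    (M : ModuleCat.{0} R) (hM : ∀ j, n < j → ∀ I : Ideal R, Van I j M)
    (q : ℕ) (T : Finset R) (hT : T.card ≤ q * c) (j : ℕ) (hj : n - (n - 1) / c + q < j) :
    Van (Ideal.span (T : Set R) ⊔ s.inf Q) j M := by
  classical
  induction s using Finset.induction_on generalizing q T j with
  | empty =>
    rw [Finset.inf_empty, sup_top_eq]
    exact van_top _ _
  | insert i s hi ih =>
    rw [Finset.inf_insert, van_congr (radical_sup_inf _ _ _)]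
    obtain ⟨T', hT', hc⟩ := hQ i (by simp)
    have hT₂ : Ideal.span ((T ∪ T' : Finset R) : Set R) = Ideal.span (T : Set R) ⊔ Q i := by
      rw [Finset.coe_union, Ideal.span_union, hT']
    have hcard : (T ∪ T').card ≤ (q + 1) * c := by
      have := Finset.card_union_le T T'
      rw [add_mul]; lia
    obtain ⟨j, rfl⟩ : ∃ k, j = k + 1 := ⟨j - 1, by lia⟩
    refine van_inf ?_ (ih (fun i hi ↦ hQ i (by simp [hi])) q T hT _ hj) ?_
    · rw [← hT₂]
      by_cases hq : q + 1 ≤ (n - 1) / c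
      · refine van_span_finset _ _ _ (hcard.trans_lt ?_)
        have h1 : (n - 1) / c * c ≤ n - 1 := Nat.div_mul_le_self _ _
        have h2 : 0 < (n - 1) / c := by lia
        have hn : 0 < n - 1 := Nat.pos_of_ne_zero (by rintro h; simp [h] at h2)
        have hc : 0 < c := Nat.pos_of_ne_zero (by rintro rfl; simp at h2)
        generalize (n - 1) / c = t at *
        obtain ⟨d, rfl⟩ : ∃ d, c = d + 1 := ⟨c - 1, by lia⟩
        have h3 : (q + 1) * d ≤ t * d := Nat.mul_le_mul_right _ hq
        rw [mul_add, mul_one] at h1 ⊢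
        lia
      · refine hM _ ?_ _
        have := Nat.div_le_self (n - 1) c
        lia
    · have h := ih (fun i hi ↦ hQ i (by simp [hi])) (q + 1) (T ∪ T') hcard (j + 1 + 1) (by lia)
      rw [hT₂] at h
      convert h using 1
      rw [sup_sup_sup_comm, sup_idem, sup_assoc]

end Cover

end FV

namespace FV

section Split

open TensorProduct PrimeSpectrum

lemma comap_surjective_baseChange (A B C : Type) [CommRing A] [CommRing B] [CommRing C]
    [Algebra A B] [Algebra A C] (h : Function.Surjective (comap (algebraMap A B))) :
    Function.Surjective (comap (algebraMap C (C ⊗[A] B))) := by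
  intro p
  change p ∈ Set.range _
  rw [← nontrivial_iff_mem_rangeComap]
  let p₀ := comap (algebraMap A C) p
  have h₀ : Nontrivial (p₀.asIdeal.ResidueField ⊗[A] B) :=
    (nontrivial_iff_mem_rangeComap p₀).2 (h p₀)
  let _ : Algebra p₀.asIdeal.ResidueField p.asIdeal.ResidueField :=
    (Ideal.ResidueField.map p₀.asIdeal p.asIdeal (algebraMap A C) rfl).toAlgebra
  have : IsScalarTower A p₀.asIdeal.ResidueField p.asIdeal.ResidueField := .of_algebraMap_eq fun x ↦
    (IsScalarTower.algebraMap_apply A C p.asIdeal.ResidueField x).trans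
      (Ideal.ResidueField.map_algebraMap p₀.asIdeal p.asIdeal (algebraMap A C) rfl x).symm
  have h₁ : Nontrivial (p.asIdeal.ResidueField ⊗[p₀.asIdeal.ResidueField]
      (p₀.asIdeal.ResidueField ⊗[A] B)) := inferInstance
  have h₂ : Nontrivial (p.asIdeal.ResidueField ⊗[A] B) :=
    (AlgebraTensorModule.cancelBaseChange A p₀.asIdeal.ResidueField
      p.asIdeal.ResidueField p.asIdeal.ResidueField B).toEquiv.nontrivial_congr.1 h₁
  exact (AlgebraTensorModule.cancelBaseChange A C
      p.asIdeal.ResidueField p.asIdeal.ResidueField B).toEquiv.nontrivial_congr.2 h₂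

lemma ringKrullDim_le_of_isIntegral (R R' : Type) [CommRing R] [CommRing R'] [Algebra R R']
    [Algebra.IsIntegral R R'] : ringKrullDim R' ≤ ringKrullDim R := by
  refine Order.krullDim_le_of_strictMono (PrimeSpectrum.comap (algebraMap R R')) fun p q h ↦ ?_
  have h' : p.asIdeal < q.asIdeal := h
  exact Ideal.IsIntegral.comap_lt_comap h'

/-- After some finite extension `R'` of `R` which is surjective on spectra, the closed set
`V(P)` becomes a finite union of closed sets, each defined by at most `c` equations. -/
def HasSplit (R : Type) [CommRing R] (P : Ideal R) (c : ℕ) : Prop :=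
  ∃ (R' : Type) (_ : CommRing R') (_ : Algebra R R') (ι : Type) (s : Finset ι) (Q : ι → Ideal R'),
    Module.Finite R R' ∧ Function.Surjective (comap (algebraMap R R')) ∧
    (∀ i ∈ s, ∃ T : Finset R', Ideal.span (T : Set R') = Q i ∧ T.card ≤ c) ∧
    ∀ q : Ideal R', q.IsPrime → (P.map (algebraMap R R') ≤ q ↔ ∃ i ∈ s, Q i ≤ q)

variable {R : Type} [CommRing R]

lemma HasSplit.inf {P₁ P₂ : Ideal R} {c : ℕ} (h₁ : HasSplit R P₁ c) (h₂ : HasSplit R P₂ c) :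
    HasSplit R (P₁ ⊓ P₂) c := by
  classical
  obtain ⟨R₁, _, _, ι₁, s₁, Q₁, hf₁, hs₁, hQ₁, h₁⟩ := h₁
  obtain ⟨R₂, _, _, ι₂, s₂, Q₂, hf₂, hs₂, hQ₂, h₂⟩ := h₂
  let f₁ : R₁ →ₐ[R] R₁ ⊗[R] R₂ := Algebra.TensorProduct.includeLeft
  let f₂ : R₂ →ₐ[R] R₁ ⊗[R] R₂ := Algebra.TensorProduct.includeRight
  refine ⟨R₁ ⊗[R] R₂, inferInstance, inferInstance, ι₁ ⊕ ι₂, s₁.disjSum s₂,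
    Sum.elim (fun i ↦ (Q₁ i).map f₁) (fun i ↦ (Q₂ i).map f₂), inferInstance, ?_, ?_, ?_⟩
  · rw [IsScalarTower.algebraMap_eq R R₁ (R₁ ⊗[R] R₂), comap_comp]
    exact hs₁.comp (comap_surjective_baseChange R R₂ R₁ hs₂)
  · rintro (i | i) hi
    · obtain ⟨T, hT, hc⟩ := hQ₁ i (Finset.inl_mem_disjSum.1 hi)
      refine ⟨T.image f₁, ?_, Finset.card_image_le.trans hc⟩
      rw [Finset.coe_image, ← Ideal.map_span, hT]; rfl
    · obtain ⟨T, hT, hc⟩ := hQ₂ i (Finset.inr_mem_disjSum.1 hi)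
      refine ⟨T.image f₂, ?_, Finset.card_image_le.trans hc⟩
      rw [Finset.coe_image, ← Ideal.map_span, hT]; rfl
  · intro q hq
    have e₁ := h₁ (q.comap f₁) inferInstance
    have e₂ := h₂ (q.comap f₂) inferInstance
    have k₁ : ∀ P : Ideal R, P.map (algebraMap R R₁) ≤ q.comap f₁ ↔ P ≤ q.comap (algebraMap R _) := by
      intro P
      rw [Ideal.map_le_iff_le_comap]
      rfl
    have k₂ : ∀ P : Ideal R, P.map (algebraMap R R₂) ≤ q.comap f₂ ↔ P ≤ q.comap (algebraMap R _) := by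
      intro P
      rw [Ideal.map_le_iff_le_comap, ← f₂.comp_algebraMap]
      rfl
    rw [k₁] at e₁
    rw [k₂] at e₂
    rw [Ideal.map_le_iff_le_comap, (inferInstance : (q.comap (algebraMap R _)).IsPrime).inf_le, e₁,
      e₂]
    simp [Ideal.map_le_iff_le_comap]

lemma HasSplit.finset_inf (F : Finset (Ideal R)) {c : ℕ} (h : ∀ P ∈ F, HasSplit R P c) :
    HasSplit R (F.inf id) c := by
  classical
  induction F using Finset.induction_on with
  | empty =>
    refine ⟨R, inferInstance, inferInstance, PEmpty, ∅, PEmpty.elim, inferInstance, ?_, by simp, ?_⟩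
    · intro p; exact ⟨p, rfl⟩
    · intro q hq
      simpa using hq.ne_top
  | insert P F hP ih =>
    rw [Finset.inf_insert]
    exact (h P (by simp)).inf (ih fun P hP ↦ h P (by simp [hP]))

lemma HasSplit.congr {P P' : Ideal R} {c : ℕ} (h : P.radical = P'.radical) (hP : HasSplit R P c) :
    HasSplit R P' c := by
  obtain ⟨R', _, _, ι, s, Q, hf, hs, hQ, h'⟩ := hP
  refine ⟨R', _, _, ι, s, Q, hf, hs, hQ, fun q hq ↦ ?_⟩
  rw [← h' q hq, Ideal.map_le_iff_le_comap, Ideal.map_le_iff_le_comap,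
    ← (Ideal.IsPrime.comap (algebraMap R R')).radical_le_iff, ← h,
    (Ideal.IsPrime.comap (algebraMap R R')).radical_le_iff]

lemma hasSplit_of_minimalPrimes [IsNoetherianRing R] {I : Ideal R} {c : ℕ}
    (h : ∀ P ∈ I.minimalPrimes, HasSplit R P c) : HasSplit R I c := by
  have hfin := I.finite_minimalPrimes_of_isNoetherianRing R
  refine HasSplit.congr ?_ (HasSplit.finset_inf hfin.toFinset fun P hP ↦ h P (by simpa using hP))
  rw [← I.sInf_minimalPrimes, Finset.inf_id_eq_sInf, hfin.coe_toFinset, I.sInf_minimalPrimes,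
    Ideal.radical_idem]

lemma van_of_hasSplit [IsNoetherianRing R] {n c : ℕ} (hn : ringKrullDim R ≤ n) {I : Ideal R}
    (h : HasSplit R I c) (j : ℕ) (hj : n - (n - 1) / c < j) : Van I j (.of R R) := by
  obtain ⟨R', _, _, ι, s, Q, hf, hs, hQ, h⟩ := h
  have : IsNoetherianRing R' := IsNoetherianRing.of_finite R R'
  have hn' : ringKrullDim R' ≤ n := (ringKrullDim_le_of_isIntegral R R').trans hn
  have hrad : (I.map (algebraMap R R')).radical = (s.inf Q).radical := by
    rw [Ideal.radical_eq_sInf, Ideal.radical_eq_sInf]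
    congr 1
    ext q
    simp only [Set.mem_ofPred_eq]
    refine and_congr_left fun hq ↦ ?_
    rw [h q hq, hq.inf_le']
  refine van_descent (R' := R') (fun p hp ↦ ?_) (n - (n - 1) / c + 1) (n + 1) (fun j hj M _ _ _ ↦ ?_)
    (fun j hj q ↦ ?_) j hj R
  · obtain ⟨q, hq⟩ := hs ⟨p, hp⟩
    exact ⟨q.asIdeal, q.isPrime, ⟨(congrArg PrimeSpectrum.asIdeal hq).symm⟩⟩
  · refine van_of_supportDim_lt j M ((Module.supportDim_le_ringKrullDim _ _).trans_lt
      (hn.trans_lt ?_))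
    exact_mod_cast hj
  · have h1 : Van (I.map (algebraMap R R')) j (.of R' (R' ⧸ q)) := by
      rw [van_congr hrad]
      have := van_inf_of_cover s Q n c hQ (.of R' (R' ⧸ q)) (fun j hj J ↦
        van_of_supportDim_lt j _ ((Module.supportDim_le_ringKrullDim _ _).trans_lt
          (hn'.trans_lt (by exact_mod_cast hj)))) 0 ∅ (by simp) j (by lia)
      simpa using this
    obtain ⟨j, rfl⟩ : ∃ k, j = k + 1 := ⟨j - 1, by lia⟩
    let e : (ModuleCat.restrictScalars (algebraMap R R')).obj (.of R' (R' ⧸ q)) ≃ₗ[R] R' ⧸ q :=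
      { AddEquiv.refl (R' ⧸ q) with
        map_smul' := fun r x ↦ algebraMap_smul R' r (show R' ⧸ q from x) }
    exact Van.of_iso e.toModuleIso
      (van_restrictScalars (algebraMap R R') (RingHom.finite_algebraMap.2 hf) _ j h1)

theorem subsingleton_of_hasSplit [IsNoetherianRing R] {n c : ℕ} (hn : ringKrullDim R ≤ n)
    {I : Ideal R} (h : ∀ P ∈ I.minimalPrimes, HasSplit R P c) (j : ℕ) (hj : n - (n - 1) / c < j) :
    Subsingleton ((localCohomology I j).obj (ModuleCat.of R R)) := by
  obtain ⟨j, rfl⟩ : ∃ k, j = k + 1 := ⟨j - 1, by lia⟩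
  exact subsingleton_localCohomology j _ (van_of_hasSplit hn (hasSplit_of_minimalPrimes h) _ hj)

end Split

end FV

namespace FV

section PowerSeriesNormal

/-- A ring is completely integrally closed (phrased in terms of divisibility). -/
def CIC (A : Type) [CommRing A] : Prop :=
  ∀ a b c : A, b ≠ 0 → c ≠ 0 → (∀ n, b ^ n ∣ c * a ^ n) → b ∣ a

open PowerSeries in
lemma exists_eq_X_pow_mul {A : Type} [CommRing A] {f : PowerSeries A} (hf : f ≠ 0) :
    ∃ (m : ℕ) (g : PowerSeries A), f = X ^ m * g ∧ constantCoeff g ≠ 0 :=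
  ⟨_, _, X_pow_order_mul_divXPowOrder.symm, fun h ↦ hf (constantCoeff_divXPowOrder_eq_zero_iff.1 h)⟩

open PowerSeries in
lemma dvd_of_dvd_X_pow_mul {A : Type} [CommRing A] [IsDomain A] {b z : PowerSeries A} (k : ℕ)
    (hb : constantCoeff b ≠ 0) (h : b ∣ X ^ k * z) : b ∣ z := by
  obtain ⟨y, hy⟩ := h
  obtain ⟨w, rfl⟩ := X_prime.pow_dvd_of_dvd_mul_left (a := b) k (fun h ↦ hb (X_dvd_iff.1 h))
    ⟨z, hy.symm⟩
  refine ⟨w, mul_left_cancel₀ (pow_ne_zero k X_ne_zero) (hy.trans (by ring))⟩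

open PowerSeries in
lemma CIC.dvd_powerSeries {A : Type} [CommRing A] [IsDomain A] (hA : CIC A) {b c : PowerSeries A}
    (hb : constantCoeff b ≠ 0) (hc : constantCoeff c ≠ 0) (a : PowerSeries A)
    (h : ∀ n, b ^ n ∣ c * a ^ n) : b ∣ a := by
  have step : ∀ a : {a : PowerSeries A // ∀ n, b ^ n ∣ c * a ^ n},
      ∃ (q : A) (a' : {a : PowerSeries A // ∀ n, b ^ n ∣ c * a ^ n}), a.1 = C q * b + X * a'.1 := by
    rintro ⟨a, h⟩
    have : constantCoeff b ∣ constantCoeff a := by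
      refine hA _ _ _ hb hc fun n ↦ ?_
      simpa using map_dvd constantCoeff (h n)
    obtain ⟨q, hq⟩ := this
    have h1 : X ∣ a - C q * b := by
      rw [X_dvd_iff, map_sub, map_mul, hq, constantCoeff_C]; ring
    obtain ⟨a', ha'⟩ := h1
    refine ⟨q, ⟨a', fun n ↦ ?_⟩, by simp [← ha']⟩
    refine dvd_of_dvd_X_pow_mul n (by simpa using pow_ne_zero n hb) ?_
    have h2 : X ^ n * (c * a' ^ n) = c * (a - C q * b) ^ n := by rw [ha']; ring
    rw [h2, sub_eq_add_neg, add_pow, Finset.mul_sum]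
    refine Finset.dvd_sum fun i hi ↦ ?_
    have h3 : b ^ n = b ^ i * b ^ (n - i) := by
      rw [← pow_add, Nat.add_sub_cancel' (Finset.mem_range_succ_iff.1 hi)]
    rw [h3, ← neg_mul, mul_pow, show c * (a ^ i * ((-C q) ^ (n - i) * b ^ (n - i)) * (n.choose i : PowerSeries A))
      = (c * a ^ i) * b ^ (n - i) * ((-C q) ^ (n - i) * (n.choose i : PowerSeries A)) by ring]
    exact (mul_dvd_mul_right (h i) _).mul_right _
  choose q s hs using step
  let u : ℕ → {a : PowerSeries A // ∀ n, b ^ n ∣ c * a ^ n} := fun k ↦ s^[k] ⟨a, h⟩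
  have hu : ∀ k, (u k).1 = C (q (u k)) * b + X * (u (k + 1)).1 := fun k ↦ by
    rw [hs (u k)]; simp only [u, Function.iterate_succ_apply']
  let Q : PowerSeries A := PowerSeries.mk fun k ↦ q (u k)
  have key : ∀ k, a = (∑ i ∈ Finset.range k, C (q (u i)) * X ^ i) * b + X ^ k * (u k).1 := by
    intro k
    induction k with
    | zero => simp [u]
    | succ k ih =>
      rw [ih, Finset.sum_range_succ, hu k]
      ring
  refine ⟨Q, ?_⟩
  rw [← sub_eq_zero]
  ext k
  have h5 : ∀ k, X ^ (k + 1) ∣ a - b * Q := by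
    intro k
    have h6 : X ^ (k + 1) ∣ Q - ∑ i ∈ Finset.range (k + 1), C (q (u i)) * X ^ i := by
      rw [X_pow_dvd_iff]
      intro m hm
      simp only [map_sub, map_sum, Q, coeff_mk, coeff_C_mul, coeff_X_pow, mul_ite, mul_one, mul_zero]
      rw [Finset.sum_ite_eq, if_pos (Finset.mem_range.2 hm), sub_self]
    have h7 : a - b * Q = X ^ (k + 1) * (u (k + 1)).1 -
        b * (Q - ∑ i ∈ Finset.range (k + 1), C (q (u i)) * X ^ i) := by
      conv_lhs => rw [key (k + 1)]
      ring
    rw [h7]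
    exact dvd_sub (dvd_mul_right _ _) (h6.mul_left _)
  exact (X_pow_dvd_iff.1 (h5 k)) k (by simp)

open PowerSeries in
lemma CIC.powerSeries {A : Type} [CommRing A] [IsDomain A] (hA : CIC A) : CIC (PowerSeries A) := by
  intro a b c hb hc h
  by_cases ha : a = 0
  · simp [ha]
  obtain ⟨s, b, rfl, hb'⟩ := exists_eq_X_pow_mul hb
  obtain ⟨t, c, rfl, hc'⟩ := exists_eq_X_pow_mul hc
  obtain ⟨u, a, rfl, ha'⟩ := exists_eq_X_pow_mul ha
  have h1 : ∀ n, s * n ≤ t + u * n := by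
    intro n
    by_contra! hlt
    have h2 : (X : PowerSeries A) ^ (s * n) ∣ X ^ (t + u * n) * (c * a ^ n) := by
      refine (Dvd.intro (b ^ n) ?_).trans ((h n).trans (dvd_of_eq ?_)) <;> ring
    obtain ⟨w, hw⟩ := h2
    obtain ⟨e, he⟩ := Nat.exists_eq_add_of_lt hlt
    have h3 : c * a ^ n = X * (X ^ e * w) := by
      refine mul_left_cancel₀ (pow_ne_zero (t + u * n) X_ne_zero) (hw.trans ?_)
      rw [he]; ring
    have h4 := congrArg constantCoeff h3
    simp [hc', ha'] at h4
  have hsu : s ≤ u := by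
    by_contra! hlt
    have := h1 (t + 1)
    nlinarith
  refine mul_dvd_mul (pow_dvd_pow _ hsu) (hA.dvd_powerSeries hb' hc' a fun n ↦ ?_)
  refine dvd_of_dvd_X_pow_mul (t + u * n) (by simpa using pow_ne_zero n hb') ?_
  refine (Dvd.intro_left ((X ^ s) ^ n) ?_).trans ((h n).trans (dvd_of_eq ?_))
  · ring
  · ring

lemma CIC.of_ringEquiv {A B : Type} [CommRing A] [CommRing B] (e : A ≃+* B) (hA : CIC A) :
    CIC B := by
  intro a b c hb hc h
  have := hA (e.symm a) (e.symm b) (e.symm c) (by simpa) (by simpa) fun n ↦ by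
    simpa using map_dvd e.symm (h n)
  simpa using map_dvd e this

lemma CIC.isIntegrallyClosed {A : Type} [CommRing A] [IsDomain A] (hA : CIC A) :
    IsIntegrallyClosed A := by
  refine (isIntegrallyClosed_iff (FractionRing A)).2 fun {x} hx ↦ ?_
  obtain ⟨c, hc, h⟩ := hx.isAlmostIntegral
  obtain ⟨a, b, hb, rfl⟩ := IsFractionRing.div_surjective (A := A) x
  have hb0 := nonZeroDivisors.ne_zero hb
  have hb' : algebraMap A (FractionRing A) b ≠ 0 := by simpa using hb0
  obtain ⟨q, rfl⟩ := hA a b c hb0 (nonZeroDivisors.ne_zero hc) fun n ↦ by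
    obtain ⟨z, hz⟩ := h n
    refine ⟨z, FaithfulSMul.algebraMap_injective A (FractionRing A) ?_⟩
    rw [map_mul, map_mul, hz, Algebra.smul_def, map_pow, map_pow, div_pow]
    field_simp
  exact ⟨q, by rw [map_mul]; field_simp⟩

lemma CIC.field (K : Type) [Field K] : CIC K := fun _ b _ hb _ _ ↦ (IsUnit.mk0 b hb).dvd

instance isDomain_mvPowerSeries (K σ : Type) [Field K] : IsDomain (MvPowerSeries σ K) :=
  NoZeroDivisors.to_isDomain _

lemma cic_mvPowerSeries_fin (K : Type) [Field K] (n : ℕ) : CIC (MvPowerSeries (Fin n) K) := by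
  induction n with
  | zero => exact 
    (CIC.field K).of_ringEquiv (MvPowerSeries.isEmptyEquiv (σ := Fin 0) (R := K)).symm.toRingEquiv
  | succ n ih => exact ih.powerSeries.of_ringEquiv (MvPowerSeries.finSuccEquiv K n).symm.toRingEquiv

instance isIntegrallyClosed_mvPowerSeries (K σ : Type) [Field K] [Finite σ] :
    IsIntegrallyClosed (MvPowerSeries σ K) := by
  have : Fintype σ := Fintype.ofFinite σ
  exact ((cic_mvPowerSeries_fin K _).of_ringEquiv
    (MvPowerSeries.renameEquiv (R := K) (Fintype.equivFin σ).symm).toRingEquiv).isIntegrallyClosed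

end PowerSeriesNormal

section PowerSeriesLocal

open MvPowerSeries

variable (K σ : Type) [Field K] [Finite σ]

lemma maximalIdeal_mvPowerSeries :
    IsLocalRing.maximalIdeal (MvPowerSeries σ K) = Ideal.span (Set.range X) := by
  classical
  have : Fintype σ := Fintype.ofFinite σ
  refine le_antisymm (fun f hf ↦ ?_) (Ideal.span_le.2 ?_)
  · have h0 : constantCoeff f = 0 := by
      by_contra h
      exact hf (isUnit_iff_constantCoeff.2 (IsUnit.mk0 _ h))
    have hex : ∀ m : σ →₀ ℕ, m ≠ 0 → ∃ i, m i ≠ 0 := fun m hm ↦ by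
      by_contra! h
      exact hm (Finsupp.ext h)
    have hex' : ∀ m : σ →₀ ℕ, ∃ i : Option σ, m ≠ 0 → ∃ s, i = some s ∧ m s ≠ 0 := fun m ↦ by
      by_cases hm : m = 0
      · exact ⟨none, fun h ↦ (h hm).elim⟩
      · obtain ⟨s, hs⟩ := hex m hm
        exact ⟨some s, fun _ ↦ ⟨s, rfl, hs⟩⟩
    choose i hi using hex'
    let g : σ → MvPowerSeries σ K := fun s m ↦ if i m = some s then coeff m f else 0
    have hg : ∀ s m, coeff m (g s) = if i m = some s then coeff m f else 0 := fun s m ↦ rfl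
    have hf' : f = ∑ s, g s := by
      ext m
      rw [map_sum]
      simp only [hg]
      by_cases hm : m = 0
      · subst hm
        rw [coeff_zero_eq_constantCoeff_apply, h0]
        simp
      · obtain ⟨s, hs, _⟩ := hi m hm
        simp [hs]
    rw [hf']
    refine Ideal.sum_mem _ fun s _ ↦ ?_
    obtain ⟨z, hz⟩ : X s ∣ g s := by
      rw [X_dvd_iff]
      intro m hm
      rw [hg]
      split_ifs with h1
      · by_cases hm0 : m = 0
        · subst hm0
          rwa [coeff_zero_eq_constantCoeff_apply]
        · obtain ⟨s', hs', h2⟩ := hi m hm0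
          rw [hs', Option.some_inj] at h1
          exact (h2 (h1 ▸ hm)).elim
      · rfl
    rw [hz]
    exact Ideal.mul_mem_right _ _ (Ideal.subset_span ⟨s, rfl⟩)
  · rintro _ ⟨s, rfl⟩ h
    simpa using isUnit_iff_constantCoeff.1 h

instance isAdicComplete_maximalIdeal_mvPowerSeries :
    IsAdicComplete (IsLocalRing.maximalIdeal (MvPowerSeries σ K)) (MvPowerSeries σ K) := by
  rw [maximalIdeal_mvPowerSeries]
  infer_instance

lemma ringKrullDim_mvPowerSeries_le [Fintype σ] :
    ringKrullDim (MvPowerSeries σ K) ≤ Fintype.card σ := by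
  refine (ringKrullDim_le_spanFinrank_maximalIdeal (R := MvPowerSeries σ K)).trans ?_
  rw [maximalIdeal_mvPowerSeries]
  exact_mod_cast (Submodule.spanFinrank_span_le_ncard_of_finite (Set.finite_range _)).trans
    (by
      rw [← Set.image_univ]
      exact (Set.ncard_image_le Set.finite_univ).trans (by simp [Set.ncard_univ]))

variable {K σ}

lemma exists_algHom_mvPowerSeries {R : Type} [CommRing R] [Algebra K R] (I : Ideal R)
    [IsAdicComplete I R] (y : σ → R) (hy : ∀ i, y i ∈ I) :
    ∃ φ : MvPowerSeries σ K →ₐ[K] R, ∀ i, φ (X i) = y i := by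
  let f : (n : ℕ) → MvPowerSeries σ K →ₐ[K] R ⧸ I ^ n := fun n ↦
    (Ideal.quotientMapₐ (I ^ n) (MvPolynomial.aeval y) (by
      change _ ≤ (I ^ n).comap (MvPolynomial.aeval (R := K) y)
      rw [← Ideal.map_le_iff_le_comap, Ideal.map_pow]
      refine Ideal.pow_right_mono (Ideal.map_le_iff_le_comap.2 (Ideal.span_le.2 ?_)) n
      rintro _ ⟨i, rfl⟩
      simpa using hy i)).comp ((truncTotalAlgHom σ K n).restrictScalars K)
  have hf : ∀ n p, f n p = Ideal.Quotient.mk (I ^ n) (MvPolynomial.aeval y (truncTotal n p)) :=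
    fun n p ↦ rfl
  have hmem : ∀ n, ∀ p ∈ MvPolynomial.idealOfVars σ K ^ n, MvPolynomial.aeval y p ∈ I ^ n := by
    intro n
    change _ ≤ (I ^ n).comap (MvPolynomial.aeval (R := K) y)
    rw [← Ideal.map_le_iff_le_comap, Ideal.map_pow]
    refine Ideal.pow_right_mono (Ideal.map_le_iff_le_comap.2 (Ideal.span_le.2 ?_)) n
    rintro _ ⟨i, rfl⟩
    simpa using hy i
  have hle : ∀ {m n : ℕ} (hle : m ≤ n),
      (Ideal.Quotient.factorₐ K (Ideal.pow_le_pow_right hle)).comp (f n) = f m := by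
    intro m n hmn
    ext p
    rw [AlgHom.comp_apply, hf, hf]
    change Ideal.Quotient.mk (I ^ m) _ = _
    rw [Ideal.Quotient.mk_eq_mk_iff_sub_mem, ← map_sub]
    exact hmem m _ (truncTotal_sub_truncTotal_mem_pow_idealOfVars hmn le_rfl p)
  refine ⟨IsAdicComplete.liftAlgHom I f hle, fun i ↦ ?_⟩
  refine IsHausdorff.eq_iff_smodEq (I := I).2 fun n ↦ ?_
  rw [SModEq.sub_mem, smul_eq_mul, Ideal.mul_top, ← Ideal.Quotient.mk_eq_mk_iff_sub_mem,
    IsAdicComplete.mk_liftAlgHom, hf, Ideal.Quotient.mk_eq_mk_iff_sub_mem]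
  have : y i = MvPolynomial.aeval (R := K) y (MvPolynomial.X i) := by simp
  rw [this, ← map_sub]
  refine hmem n _ ((MvPolynomial.mem_pow_idealOfVars_iff' ..).mpr fun x hx ↦ ?_)
  rw [MvPolynomial.coeff_sub, sub_eq_zero, coeff_truncTotal _ hx, ← MvPolynomial.coeff_coe,
    MvPolynomial.coe_X]

end PowerSeriesLocal

end FV

namespace FV

lemma isPrecomplete_pi {B ι : Type} [CommRing B] [Finite ι] (I : Ideal B) [IsPrecomplete I B] :
    IsPrecomplete I (ι → B) := by
  classical
  have : Fintype ι := Fintype.ofFinite ι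
  refine ⟨fun f hf ↦ ?_⟩
  have h1 (i : ι) : ∃ L : B, ∀ n, f n i ≡ L [SMOD (I ^ n • ⊤ : Submodule B B)] := by
    refine IsPrecomplete.prec inferInstance fun {m n} hmn ↦ ?_
    have := hf hmn
    rw [SModEq.sub_mem] at this ⊢
    have h2 := Submodule.mem_map_of_mem (f := LinearMap.proj (R := B) (φ := fun _ : ι ↦ B) i) this
    rw [Submodule.map_smul''] at h2
    exact Submodule.smul_mono le_rfl le_top h2
  choose L hL using h1
  refine ⟨L, fun n ↦ ?_⟩
  rw [SModEq.sub_mem, ← Finset.univ_sum_single (f n - L)]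
  refine Submodule.sum_mem _ fun i _ ↦ ?_
  have h2 := hL i n
  rw [SModEq.sub_mem] at h2
  have h3 := Submodule.mem_map_of_mem (f := LinearMap.single B (fun _ : ι ↦ B) i) h2
  rw [Submodule.map_smul''] at h3
  exact Submodule.smul_mono le_rfl le_top h3

section CoefficientField

open MvPowerSeries IsLocalRing

variable {R K σ : Type} [CommRing R] [IsLocalRing R] [IsNoetherianRing R] [Field K] [Finite σ]
  [Algebra K R] [Algebra (MvPowerSeries σ K) R] [IsScalarTower K (MvPowerSeries σ K) R]

omit [IsLocalRing R] [IsNoetherianRing R] [Algebra K R] [IsScalarTower K (MvPowerSeries σ K) R] in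
lemma map_maximalIdeal_mvPowerSeries :
    (maximalIdeal (MvPowerSeries σ K)).map (algebraMap (MvPowerSeries σ K) R) =
      Ideal.span (Set.range fun i ↦ algebraMap (MvPowerSeries σ K) R (X i)) := by
  rw [maximalIdeal_mvPowerSeries, Ideal.map_span, ← Set.range_comp]
  rfl

omit [Algebra K R] [IsScalarTower K (MvPowerSeries σ K) R] in
lemma linearCombination_surjective (hy : ∀ i : σ, algebraMap (MvPowerSeries σ K) R (X i) ∈ maximalIdeal R)
    (M : Type) [AddCommGroup M] [Module R M] [Module.Finite R M] [Module (MvPowerSeries σ K) M]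
    [IsScalarTower (MvPowerSeries σ K) R M] {ι : Type} [Finite ι]
    (s : ι → M) (h : ∀ x : M, ∃ c : ι →₀ MvPowerSeries σ K,
      x - Finsupp.linearCombination (MvPowerSeries σ K) s c ∈
        (Ideal.span (Set.range fun i ↦ algebraMap (MvPowerSeries σ K) R (X i)) • ⊤ : Submodule R M)) :
    Function.Surjective (Finsupp.linearCombination (MvPowerSeries σ K) s) := by
  have : Fintype ι := Fintype.ofFinite ι
  have hle : (maximalIdeal (MvPowerSeries σ K)).map (algebraMap (MvPowerSeries σ K) R) ≤ maximalIdeal R := by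
    rw [map_maximalIdeal_mvPowerSeries, Ideal.span_le]
    rintro _ ⟨i, rfl⟩
    exact hy i
  have h1 : IsHausdorff ((maximalIdeal (MvPowerSeries σ K)).map (algebraMap (MvPowerSeries σ K) R)) M :=
    IsHausdorff.of_isLocalRing _ _ fun h ↦ (maximalIdeal.isMaximal R).ne_top (top_le_iff.1 (h.symm.trans_le hle))
  have h2 : IsHausdorff (maximalIdeal (MvPowerSeries σ K)) M := IsHausdorff.map_algebraMap_iff.1 h1
  let e : (ι → MvPowerSeries σ K) →ₗ[MvPowerSeries σ K] M :=
    Finsupp.linearCombination (MvPowerSeries σ K) s ∘ₗ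
      (Finsupp.linearEquivFunOnFinite (MvPowerSeries σ K) (MvPowerSeries σ K) ι).symm.toLinearMap
  have : IsPrecomplete (maximalIdeal (MvPowerSeries σ K)) (ι → MvPowerSeries σ K) := isPrecomplete_pi _
  have h3 : Function.Surjective e := by
    refine surjective_of_mkQ_comp_surjective (I := maximalIdeal (MvPowerSeries σ K)) fun z ↦ ?_
    obtain ⟨x, rfl⟩ := Submodule.mkQ_surjective _ z
    obtain ⟨c, hc⟩ := h x
    refine ⟨c, ?_⟩
    rw [LinearMap.comp_apply, eq_comm, ← sub_eq_zero, ← map_sub, Submodule.mkQ_apply,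
      Submodule.Quotient.mk_eq_zero]
    rw [← map_maximalIdeal_mvPowerSeries] at hc
    have h4 : (Finsupp.linearEquivFunOnFinite (MvPowerSeries σ K) (MvPowerSeries σ K) ι).symm ⇑c = c := by
      ext; simp
    simp only [e, LinearMap.comp_apply, LinearEquiv.coe_coe, h4]
    rw [← Submodule.restrictScalars_top (S := MvPowerSeries σ K) (R := R) (M := M), ← Submodule.restrictScalars_map_smul_eq]
    exact hc
  exact fun x ↦ (h3 x).imp' _ fun _ h ↦ h

omit [IsNoetherianRing R] in
lemma surjective_algebraMap_quotient [IsNoetherianRing R]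
    (hK : ∀ r : R, ∃ k : K, r - algebraMap K R k ∈ maximalIdeal R)
    (hy : ∀ i : σ, algebraMap (MvPowerSeries σ K) R (X i) ∈ maximalIdeal R) (Q : Ideal R)
    (hQ : maximalIdeal R ≤ Q ⊔ Ideal.span (Set.range fun i ↦ algebraMap (MvPowerSeries σ K) R (X i))) :
    Function.Surjective (algebraMap (MvPowerSeries σ K) (R ⧸ Q)) := by
  have key := linearCombination_surjective hy (R ⧸ Q) (ι := Unit) (fun _ ↦ 1) fun x ↦ ?_
  · intro x
    obtain ⟨c, rfl⟩ := key x
    exact ⟨c (), by simp [Finsupp.linearCombination_unique, Algebra.smul_def]⟩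
  · obtain ⟨r, rfl⟩ := Ideal.Quotient.mk_surjective x
    obtain ⟨k, hk⟩ := hK r
    refine ⟨Finsupp.single () (algebraMap K _ k), ?_⟩
    rw [Finsupp.linearCombination_single, algebraMap_smul]
    obtain ⟨a, ha, b, hb, hab⟩ := Submodule.mem_sup.1 (hQ hk)
    have h1 : Ideal.Quotient.mk Q r - k • (1 : R ⧸ Q) = b • (1 : R ⧸ Q) := by
      rw [Algebra.smul_def, Algebra.smul_def, mul_one, mul_one, IsScalarTower.algebraMap_apply K R (R ⧸ Q)]
      change Ideal.Quotient.mk Q r - Ideal.Quotient.mk Q _ = Ideal.Quotient.mk Q b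
      rw [← map_sub, ← hab, map_add, Ideal.Quotient.eq_zero_iff_mem.2 ha, zero_add]
    rw [h1]
    exact Submodule.smul_mem_smul hb Submodule.mem_top

omit [Finite σ] [Algebra (MvPowerSeries σ K) R] [IsScalarTower K (MvPowerSeries σ K) R] in
lemma exists_finset_span_sup_pow (hK : ∀ r : R, ∃ k : K, r - algebraMap K R k ∈ maximalIdeal R)
    (N : ℕ) : ∃ S : Finset R, ∀ r, ∃ t ∈ Submodule.span K (S : Set R), r - t ∈ maximalIdeal R ^ N := by
  classical
  induction N with
  | zero => exact ⟨∅, fun r ↦ ⟨0, zero_mem _, by simp⟩⟩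
  | succ N ih =>
    obtain ⟨S, hS⟩ := ih
    obtain ⟨G, hG⟩ := IsNoetherian.noetherian (maximalIdeal R ^ N)
    refine ⟨S ∪ G, fun r ↦ ?_⟩
    obtain ⟨t, ht, hrt⟩ := hS r
    have h : ∀ x ∈ Submodule.span R (G : Set R), ∃ u ∈ Submodule.span K (G : Set R),
        x - u ∈ maximalIdeal R ^ (N + 1) := by
      intro x hx
      induction hx using Submodule.span_induction with
      | mem x hx => exact ⟨x, Submodule.subset_span hx, by simp⟩
      | zero => exact ⟨0, zero_mem _, by simp⟩
      | add x y _ _ hx hy =>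
        obtain ⟨u, hu, hxu⟩ := hx
        obtain ⟨v, hv, hyv⟩ := hy
        exact ⟨u + v, add_mem hu hv, by rw [add_sub_add_comm]; exact add_mem hxu hyv⟩
      | smul a x hxG hx =>
        obtain ⟨u, hu, hxu⟩ := hx
        obtain ⟨k, hk⟩ := hK a
        refine ⟨k • u, Submodule.smul_mem _ _ hu, ?_⟩
        have : a • x - k • u = (a - algebraMap K R k) * x + algebraMap K R k * (x - u) := by
          rw [smul_eq_mul, Algebra.smul_def]; ring
        rw [this]
        refine add_mem ?_ (Ideal.mul_mem_left _ _ hxu)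
        rw [pow_succ']
        exact Ideal.mul_mem_mul hk (hG ▸ hxG)
    obtain ⟨u, hu, hru⟩ := h (r - t) (by rw [hG]; exact hrt)
    refine ⟨t + u, add_mem (Submodule.span_mono (by simp) ht) (Submodule.span_mono (by simp) hu), ?_⟩
    rwa [← sub_sub]

lemma finite_of_pow_le (hK : ∀ r : R, ∃ k : K, r - algebraMap K R k ∈ maximalIdeal R)
    (hy : ∀ i : σ, algebraMap (MvPowerSeries σ K) R (X i) ∈ maximalIdeal R)
    (M : Type) [AddCommGroup M] [Module R M] [Module (MvPowerSeries σ K) M]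
    [IsScalarTower (MvPowerSeries σ K) R M] (π : R →ₗ[R] M) (hπ : Function.Surjective π) (N : ℕ)
    (hN : ∀ r ∈ maximalIdeal R ^ N, π r ∈
      (Ideal.span (Set.range fun i ↦ algebraMap (MvPowerSeries σ K) R (X i)) • ⊤ : Submodule R M)) :
    Module.Finite (MvPowerSeries σ K) M := by
  have : Module.Finite R M := Module.Finite.of_surjective π hπ
  obtain ⟨S, hS⟩ := exists_finset_span_sup_pow hK N
  refine Module.Finite.of_surjective _ (linearCombination_surjective hy M (ι := S) (fun s ↦ π s.1) fun x ↦ ?_)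
  obtain ⟨r, rfl⟩ := hπ x
  obtain ⟨t, ht, hrt⟩ := hS r
  have h : ∃ c : S →₀ MvPowerSeries σ K, Finsupp.linearCombination (MvPowerSeries σ K) (fun s : S ↦ π s.1) c = π t := by
    change π t ∈ (Finsupp.linearCombination (MvPowerSeries σ K) (fun s : S ↦ π s.1)).range
    rw [Finsupp.range_linearCombination]
    have h1 : Submodule.span K (S : Set R) ≤ (Submodule.span (MvPowerSeries σ K) (Set.range fun s : S ↦ s.1)).restrictScalars K := by
      rw [Submodule.span_le]
      intro s hs
      exact Submodule.subset_span ⟨⟨s, hs⟩, rfl⟩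
    have h2 := Submodule.mem_map_of_mem (f := π.restrictScalars (MvPowerSeries σ K)) (h1 ht)
    rw [Submodule.map_span, ← Set.range_comp] at h2
    exact h2
  obtain ⟨c, hc⟩ := h
  refine ⟨c, ?_⟩
  rw [hc, ← map_sub]
  exact hN _ hrt

end CoefficientField

end FV

namespace FV

section InjectiveOfDimension

lemma injective_of_isIntegral_of_le_ringKrullDim {B S : Type} [CommRing B] [CommRing S] [IsDomain B]
    [Algebra B S] [Algebra.IsIntegral B S] {n : ℕ} (hB : ringKrullDim B ≤ n) (hS : n ≤ ringKrullDim S) :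
    Function.Injective (algebraMap B S) := by
  by_contra hne
  obtain ⟨x, hx, hx0⟩ : ∃ x : B, algebraMap B S x = 0 ∧ x ≠ 0 := by
    by_contra! h
    exact hne ((injective_iff_map_eq_zero _).2 h)
  let _ : Algebra (B ⧸ RingHom.ker (algebraMap B S)) S := (RingHom.kerLift (algebraMap B S)).toAlgebra
  have : IsScalarTower B (B ⧸ RingHom.ker (algebraMap B S)) S := IsScalarTower.of_algebraMap_eq fun b ↦ rfl
  have : Algebra.IsIntegral (B ⧸ RingHom.ker (algebraMap B S)) S := Algebra.IsIntegral.tower_top B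
  have h1 := ringKrullDim_le_of_isIntegral (B ⧸ RingHom.ker (algebraMap B S)) S
  have h2 := ringKrullDim_succ_le_of_surjective (Ideal.Quotient.mk (RingHom.ker (algebraMap B S)))
    Ideal.Quotient.mk_surjective (mem_nonZeroDivisors_of_ne_zero hx0) (Ideal.Quotient.eq_zero_iff_mem.2 hx)
  have h3 : (n : WithBot ℕ∞) + 1 ≤ n := by
    calc (n : WithBot ℕ∞) + 1 ≤ _ := by gcongr; exact hS.trans h1
      _ ≤ _ := h2
      _ ≤ _ := hB
  have h4 : n + 1 ≤ n := by exact_mod_cast h3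
  omega

lemma ringKrullDim_le_of_isIntegral_of_injective {B S : Type} [CommRing B] [CommRing S]
    [Algebra B S] [Algebra.IsIntegral B S] (h : Function.Injective (algebraMap B S)) :
    ringKrullDim B ≤ ringKrullDim S := by
  refine iSup_le fun l ↦ ?_
  obtain ⟨P, -, hP, hP'⟩ := Ideal.exists_ideal_over_prime_of_isIntegral l.head.asIdeal (⊥ : Ideal S)
    (by rw [← RingHom.ker_eq_comap_bot, (RingHom.injective_iff_ker_eq_bot _).1 h]; exact bot_le)
  have : P.LiesOver l.head.asIdeal := ⟨hP'.symm⟩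
  obtain ⟨L, hL, -⟩ := Ideal.exists_ltSeries_of_hasGoingUp l P
  rw [← hL]
  exact Order.LTSeries.length_le_krullDim L

lemma ringKrullDim_quotient_add_height_le {R : Type} [CommRing R] (J : Ideal R) :
    ringKrullDim (R ⧸ J) + J.height ≤ ringKrullDim R := by
  have key (l : LTSeries (PrimeSpectrum (R ⧸ J))) :
      J.height + l.length ≤ (l.last.asIdeal.comap (Ideal.Quotient.mk J)).height := by
    induction l using RelSeries.inductionOn' with
    | singleton q =>
      simp only [RelSeries.singleton_length, Nat.cast_zero, add_zero, RelSeries.last_singleton]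
      refine Ideal.height_mono fun x hx ↦ ?_
      rw [Ideal.mem_comap, Ideal.Quotient.eq_zero_iff_mem.2 hx]
      exact zero_mem _
    | snoc l q hq ih =>
      rw [RelSeries.last_snoc, RelSeries.snoc_length, Nat.cast_add, ← add_assoc]
      refine (add_le_add_left ih 1).trans ?_
      have hlt : l.last.asIdeal < q.asIdeal := hq
      refine Ideal.height_add_one_le_of_lt_of_isPrime (lt_of_le_of_ne (Ideal.comap_mono hlt.le) fun h ↦ hlt.ne ?_)
      exact Ideal.comap_injective_of_surjective _ Ideal.Quotient.mk_surjective h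
  rcases subsingleton_or_nontrivial (R ⧸ J) with h | h
  · rw [ringKrullDim_eq_bot_of_subsingleton]; simp
  · rw [ringKrullDim, Order.krullDim_eq_iSup_length]
    have : Nontrivial R := (Ideal.Quotient.mk J).domain_nontrivial
    have h1 : ringKrullDim R = _ := Order.krullDim_eq_iSup_length (α := PrimeSpectrum R)
    rw [h1, ← WithBot.coe_add, WithBot.coe_le_coe, ENat.iSup_add]
    refine iSup_le fun l ↦ ?_
    rw [← WithBot.coe_le_coe, ← h1, add_comm]
    exact (WithBot.coe_le_coe.2 (key l)).trans Ideal.height_le_ringKrullDim_of_isPrime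

end InjectiveOfDimension

end FV

namespace FV

lemma natCast_le_of_add_le_add {a b : ℕ} {d : WithBot ℕ∞} (h : (a : WithBot ℕ∞) + b ≤ d + b) :
    (a : WithBot ℕ∞) ≤ d := by
  induction d using WithBot.recBotCoe with
  | bot => exact absurd (le_bot_iff.1 (WithBot.bot_add (b : WithBot ℕ∞) ▸ h)) (by norm_cast)
  | coe d =>
    induction d using ENat.recTopCoe with
    | top => exact le_top
    | coe d =>
      have : a + b ≤ d + b := by exact_mod_cast h
      have : a ≤ d := by omega
      exact_mod_cast this

section CoordinatePrimes

open MvPowerSeries IsLocalRing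

variable {K σ : Type} [Field K] [Fintype σ]

omit [Fintype σ] in
lemma sub_algebraMap_constantCoeff_mem (r : MvPowerSeries σ K) :
    r - algebraMap K _ (constantCoeff r) ∈ maximalIdeal (MvPowerSeries σ K) := by
  rw [mem_maximalIdeal, mem_nonunits_iff, MvPowerSeries.isUnit_iff_constantCoeff, map_sub]
  change ¬ IsUnit (_ - constantCoeff (C _))
  simp

lemma X_mem_maximalIdeal (i : σ) : (X i : MvPowerSeries σ K) ∈ maximalIdeal (MvPowerSeries σ K) := by
  rw [maximalIdeal_mvPowerSeries]
  exact Ideal.subset_span ⟨i, rfl⟩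

variable (hd : (Fintype.card σ : WithBot ℕ∞) ≤ ringKrullDim (MvPowerSeries σ K))
include hd

lemma exists_ringHom_bijective_quotient_span_X (T : Finset σ) :
    ∃ f : MvPowerSeries {i // i ∉ T} K →+*
        MvPowerSeries σ K ⧸ Ideal.span (((X : σ → MvPowerSeries σ K) '' (T : Set σ))),
      Function.Bijective f ∧ ∀ i, f (X i) = Ideal.Quotient.mk _ (X i.1) := by
  classical
  set Z : Ideal (MvPowerSeries σ K) := Ideal.span (((X : σ → MvPowerSeries σ K) '' (T : Set σ)))
  obtain ⟨φ, hφ⟩ := exists_algHom_mvPowerSeries (K := K) (σ := {i // i ∉ T})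
    (maximalIdeal (MvPowerSeries σ K)) (fun i ↦ X i.1) (fun i ↦ X_mem_maximalIdeal i.1)
  let _ : Algebra (MvPowerSeries {i // i ∉ T} K) (MvPowerSeries σ K) := φ.toRingHom.toAlgebra
  have : IsScalarTower K (MvPowerSeries {i // i ∉ T} K) (MvPowerSeries σ K) :=
    IsScalarTower.of_algebraMap_eq fun k ↦ (φ.commutes k).symm
  have hX (i : {i // i ∉ T}) : algebraMap (MvPowerSeries {i // i ∉ T} K) (MvPowerSeries σ K) (X i) = X i.1 := hφ i
  have hsurj : Function.Surjective (algebraMap (MvPowerSeries {i // i ∉ T} K) (MvPowerSeries σ K ⧸ Z)) := by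
    refine surjective_algebraMap_quotient (fun r ↦ ⟨constantCoeff r, sub_algebraMap_constantCoeff_mem r⟩)
      (fun i ↦ by rw [hX]; exact X_mem_maximalIdeal i.1) Z ?_
    rw [maximalIdeal_mvPowerSeries, Ideal.span_le]
    rintro _ ⟨i, rfl⟩
    by_cases hi : i ∈ T
    · exact Ideal.mem_sup_left (Ideal.subset_span ⟨i, hi, rfl⟩)
    · exact Ideal.mem_sup_right (Ideal.subset_span ⟨⟨i, hi⟩, hX _⟩)
  have hintg : Algebra.IsIntegral (MvPowerSeries {i // i ∉ T} K) (MvPowerSeries σ K ⧸ Z) :=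
    ⟨fun x ↦ by obtain ⟨y, rfl⟩ := hsurj x; exact isIntegral_algebraMap⟩
  have hZ : ringKrullDim (MvPowerSeries σ K) ≤ ringKrullDim (MvPowerSeries σ K ⧸ Z) + (T.card : ℕ) := by
    have := ringKrullDim_le_ringKrullDim_quotient_add_card (T.image (X : σ → MvPowerSeries σ K)) (by
      intro x hx
      rw [Finset.coe_image] at hx
      obtain ⟨i, -, rfl⟩ := hx
      rw [SetLike.mem_coe, IsLocalRing.ringJacobson_eq_maximalIdeal]
      exact X_mem_maximalIdeal i)
    rw [Finset.coe_image] at this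
    refine this.trans (add_le_add_right ?_ _)
    exact_mod_cast Finset.card_image_le
  have hinj := injective_of_isIntegral_of_le_ringKrullDim (B := MvPowerSeries {i // i ∉ T} K)
    (S := MvPowerSeries σ K ⧸ Z) (ringKrullDim_mvPowerSeries_le K {i // i ∉ T}) (by
      have h1 := hd.trans hZ
      have h2 : Fintype.card {i // i ∉ T} + T.card = Fintype.card σ := by
        rw [Fintype.card_subtype_compl, Fintype.card_coe]
        have := T.card_le_univ
        omega
      rw [← h2, Nat.cast_add] at h1
      exact natCast_le_of_add_le_add h1)
  exact ⟨algebraMap _ _, ⟨hinj, hsurj⟩, fun i ↦ congrArg (Ideal.Quotient.mk Z) (hX i)⟩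

lemma isPrime_span_X (T : Finset σ) :
    (Ideal.span (((X : σ → MvPowerSeries σ K) '' (T : Set σ)))).IsPrime := by
  obtain ⟨f, hf, -⟩ := exists_ringHom_bijective_quotient_span_X hd T
  rw [← Ideal.Quotient.isDomain_iff_prime]
  exact (RingEquiv.ofBijective f hf).symm.toMulEquiv.isDomain _

lemma card_le_height_span_X (T : Finset σ) :
    T.card ≤ (Ideal.span (((X : σ → MvPowerSeries σ K) '' (T : Set σ)))).height := by
  classical
  induction T using Finset.induction_on with
  | empty => simp
  | insert a T ha ih =>
    have := isPrime_span_X hd T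
    have := isPrime_span_X hd (insert a T)
    rw [Finset.card_insert_of_notMem ha, Nat.cast_add]
    refine (add_le_add_left ih _).trans (Ideal.height_add_one_le_of_lt_of_isPrime (lt_of_le_of_ne
      (Ideal.span_mono (Set.image_mono (by simp))) fun h ↦ ?_))
    obtain ⟨f, hf, hX⟩ := exists_ringHom_bijective_quotient_span_X hd T
    have h1 : (X a : MvPowerSeries σ K) ∈ Ideal.span (((X : σ → MvPowerSeries σ K) '' (T : Set σ))) := by
      rw [h]
      exact Ideal.subset_span ⟨a, by simp, rfl⟩
    have h2 := hX ⟨a, ha⟩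
    rw [Ideal.Quotient.eq_zero_iff_mem.2 h1, map_eq_zero_iff f hf.1] at h2
    have h3 := congrArg (MvPowerSeries.coeff (Finsupp.single ⟨a, ha⟩ 1)) h2
    simp [MvPowerSeries.coeff_X] at h3

end CoordinatePrimes

end FV

namespace FV

section DimensionFormula

open MvPowerSeries IsLocalRing

lemma exists_algebra_mvPowerSeries {R K σ : Type} [CommRing R] [Field K] [Finite σ] [Algebra K R]
    (I : Ideal R) [IsAdicComplete I R] (y : σ → R) (hy : ∀ i, y i ∈ I) :
    ∃ _ : Algebra (MvPowerSeries σ K) R, IsScalarTower K (MvPowerSeries σ K) R ∧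
      ∀ i, algebraMap (MvPowerSeries σ K) R (X i) = y i := by
  obtain ⟨φ, hφ⟩ := exists_algHom_mvPowerSeries (K := K) I y hy
  let _ : Algebra (MvPowerSeries σ K) R := φ.toRingHom.toAlgebra
  exact ⟨inferInstance, IsScalarTower.of_algebraMap_eq fun k ↦ (φ.commutes k).symm, hφ⟩

lemma exists_finset_quotient_maximalIdeal {R : Type} [CommRing R] [IsLocalRing R]
    [IsNoetherianRing R] (J : Ideal R) (hJ : J ≠ ⊤) :
    ∃ t : Finset R, (t : Set R) ⊆ maximalIdeal R ∧ (t.card : WithBot ℕ∞) = ringKrullDim (R ⧸ J) ∧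
      maximalIdeal R ≤ (J ⊔ Ideal.span (t : Set R)).radical := by
  classical
  have : Nontrivial (R ⧸ J) := Ideal.Quotient.nontrivial_iff.2 hJ
  have : IsLocalRing (R ⧸ J) := IsLocalRing.of_surjective' _ Ideal.Quotient.mk_surjective
  obtain ⟨s, hs, hcard⟩ := (maximalIdeal (R ⧸ J)).exists_finset_card_eq_height_of_isNoetherianRing
  choose g hg using Ideal.Quotient.mk_surjective (I := J)
  have himg : Ideal.Quotient.mk J '' (s.image g : Finset R) = s := by
    rw [Finset.coe_image, ← Set.image_comp]
    convert Set.image_id _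
    ext x
    exact hg x
  have hm : (maximalIdeal (R ⧸ J)).comap (Ideal.Quotient.mk J) = maximalIdeal R :=
    eq_maximalIdeal (Ideal.comap_isMaximal_of_surjective _ Ideal.Quotient.mk_surjective)
  refine ⟨s.image g, ?_, ?_, fun x hx ↦ ?_⟩
  · intro x hx
    rw [← hm]
    exact hs.1.2 (Ideal.subset_span (himg ▸ Set.mem_image_of_mem _ hx))
  · rw [Finset.card_image_of_injective _ (Function.LeftInverse.injective hg),
      ← maximalIdeal_height_eq_ringKrullDim, ← hcard]
    rfl
  · rw [Ideal.radical_eq_sInf, Ideal.mem_sInf]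
    rintro q ⟨hq, hqp⟩
    have hJq : J ≤ q := le_sup_left.trans hq
    have h1 : (q.map (Ideal.Quotient.mk J)).IsPrime :=
      Ideal.map_isPrime_of_surjective Ideal.Quotient.mk_surjective (by rwa [Ideal.mk_ker])
    have h2 : Ideal.span (s : Set (R ⧸ J)) ≤ q.map (Ideal.Quotient.mk J) := by
      rw [← himg, ← Ideal.map_span]
      exact Ideal.map_mono (le_sup_right.trans hq)
    have h3 := hs.2 ⟨h1, h2⟩ (le_maximalIdeal h1.ne_top)
    have h4 : (q.map (Ideal.Quotient.mk J)).comap (Ideal.Quotient.mk J) = q := by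
      rw [Ideal.comap_map_of_surjective _ Ideal.Quotient.mk_surjective, ← RingHom.ker_eq_comap_bot,
        Ideal.mk_ker, sup_eq_left.2 hJq]
    rw [← h4]
    rw [← hm] at hx
    exact h3 hx

lemma exists_finset_height {R : Type} [CommRing R] [IsNoetherianRing R] (P : Ideal R) (hP : P ≠ ⊤) :
    ∃ s : Finset R, (s : Set R) ⊆ P ∧ (s.card : ℕ∞) = P.height ∧
      (Ideal.span (s : Set R)).height = P.height := by
  obtain ⟨J, hJP, hJ1, hJ2⟩ := P.exists_spanRank_eq_and_height_eq hP
  have hfg := IsNoetherian.noetherian J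
  refine ⟨hfg.finite_generators.toFinset, ?_, ?_, ?_⟩
  · rw [Set.Finite.coe_toFinset]
    exact (Submodule.FG.generators_mem J).trans hJP
  · rw [← Set.ncard_eq_toFinset_card (hs := hfg.finite_generators), hfg.generators_ncard]
    rw [Submodule.fg_iff_spanRank_eq_spanFinrank.2 hfg] at hJ1
    exact_mod_cast hJ1
  · rw [Set.Finite.coe_toFinset, Ideal.span, J.span_generators, hJ2]

lemma ringKrullDim_le_height_add {R K : Type} [CommRing R] [IsDomain R] [IsLocalRing R]
    [IsNoetherianRing R] [Field K] [Algebra K R] [IsAdicComplete (maximalIdeal R) R]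
    (hK : ∀ r : R, ∃ k : K, r - algebraMap K R k ∈ maximalIdeal R) (P : Ideal R) [hP : P.IsPrime] :
    ringKrullDim R ≤ P.height + ringKrullDim (R ⧸ P) := by
  classical
  obtain ⟨s, hsP, hcard, hht⟩ := exists_finset_height P hP.ne_top
  set J := Ideal.span (s : Set R)
  have hJP : J ≤ P := Ideal.span_le.2 hsP
  have hJ : J ≠ ⊤ := fun h ↦ hP.ne_top (top_le_iff.1 (h ▸ hJP))
  obtain ⟨t, htm, htcard, hrad⟩ := exists_finset_quotient_maximalIdeal J hJ
  have hdim : ((t.card + s.card : ℕ) : WithBot ℕ∞) ≤ ringKrullDim R := by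
    have := ringKrullDim_quotient_add_height_le J
    rw [hht, ← hcard, ← htcard] at this
    exact_mod_cast this
  obtain ⟨_, _, hX⟩ := exists_algebra_mvPowerSeries (K := K) (σ := s ⊕ t) (maximalIdeal R)
    (Sum.elim (fun i ↦ i.1) (fun i ↦ i.1)) (by
      rintro (i | i)
      · exact le_maximalIdeal hJ (Ideal.subset_span i.2)
      · exact htm i.2)
  have hspan : Ideal.span (Set.range fun i ↦ algebraMap (MvPowerSeries (s ⊕ t) K) R (X i)) =
      J ⊔ Ideal.span (t : Set R) := by
    simp_rw [hX]
    rw [Set.Sum.elim_range, Ideal.span_union]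
    simp only [Subtype.range_coe_subtype, SetLike.setOfPred_mem_eq, J]
  have hfin : Module.Finite (MvPowerSeries (s ⊕ t) K) R := by
    obtain ⟨N, hN⟩ := Ideal.exists_pow_le_of_le_radical_of_fg hrad (IsNoetherian.noetherian _)
    refine finite_of_pow_le hK (fun i ↦ ?_) R LinearMap.id Function.surjective_id N fun r hr ↦ ?_
    · rw [hX]
      rcases i with i | i
      · exact le_maximalIdeal hJ (Ideal.subset_span i.2)
      · exact htm i.2
    · rw [hspan, smul_eq_mul, Ideal.mul_top]
      exact hN hr
  have hB := ringKrullDim_mvPowerSeries_le K (s ⊕ t)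
  rw [Fintype.card_sum, Fintype.card_coe, Fintype.card_coe, add_comm] at hB
  have hinj := injective_of_isIntegral_of_le_ringKrullDim hB hdim
  have : FaithfulSMul (MvPowerSeries (s ⊕ t) K) R := (faithfulSMul_iff_algebraMap_injective _ _).2 hinj
  have hdB : (Fintype.card (s ⊕ t) : WithBot ℕ∞) ≤ ringKrullDim (MvPowerSeries (s ⊕ t) K) := by
    rw [Fintype.card_sum, Fintype.card_coe, Fintype.card_coe, add_comm]
    exact hdim.trans (ringKrullDim_le_of_isIntegral _ _)
  set T : Finset (s ⊕ t) := Finset.univ.image Sum.inl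
  have hT : T.card = s.card := by
    rw [Finset.card_image_of_injective _ Sum.inl_injective, Finset.card_univ, Fintype.card_coe]
  set Z : Ideal (MvPowerSeries (s ⊕ t) K) :=
    Ideal.span (((X : s ⊕ t → MvPowerSeries (s ⊕ t) K) '' (T : Set (s ⊕ t))))
  have hZ : Z.IsPrime := isPrime_span_X hdB T
  have hZle : Z ≤ P.under _ := by
    rw [Ideal.span_le]
    rintro _ ⟨i, hi, rfl⟩
    obtain ⟨i, -, rfl⟩ := Finset.mem_image.1 hi
    change algebraMap _ R (X _) ∈ P
    rw [hX]
    exact hsP i.2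
  have hZP : Z = P.under _ := by
    refine Ideal.eq_of_le_of_height_le Z hZle ?_
    refine le_trans ?_ (card_le_height_span_X hdB T)
    rw [hT, hcard, Ideal.height_eq_height_add_of_liesOver_of_hasGoingDown (P.under (MvPowerSeries (s ⊕ t) K)) P]
    exact le_self_add
  have hPdim : ringKrullDim (MvPowerSeries (s ⊕ t) K ⧸ Z) ≤ ringKrullDim (R ⧸ P) := by
    have : Algebra.IsIntegral (MvPowerSeries (s ⊕ t) K ⧸ P.under (MvPowerSeries (s ⊕ t) K)) (R ⧸ P) := inferInstance
    rw [hZP]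
    exact ringKrullDim_le_of_isIntegral_of_injective Ideal.algebraMap_quotient_injective
  have hZdim := ringKrullDim_le_ringKrullDim_quotient_add_card (T.image (X : s ⊕ t → MvPowerSeries (s ⊕ t) K)) (by
    intro x hx
    rw [Finset.coe_image] at hx
    obtain ⟨i, -, rfl⟩ := hx
    rw [SetLike.mem_coe, IsLocalRing.ringJacobson_eq_maximalIdeal]
    exact X_mem_maximalIdeal i)
  rw [Finset.coe_image] at hZdim
  calc ringKrullDim R ≤ ringKrullDim (MvPowerSeries (s ⊕ t) K) := ringKrullDim_le_of_isIntegral _ _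
    _ ≤ _ := hZdim
    _ ≤ ringKrullDim (R ⧸ P) + (s.card : ℕ) := by
      refine add_le_add hPdim ?_
      rw [← hT]
      exact_mod_cast Finset.card_image_le
    _ = _ := by rw [add_comm, ← hcard]; rfl

end DimensionFormula

end FV

namespace FV

section Parameters

open IsLocalRing

lemma ringKrullDim_quotient_sup_span_singleton_add_one_le {R : Type} [CommRing R] (J : Ideal R) (v : R)
    (hv : ∀ q ∈ J.minimalPrimes, v ∉ q) :
    ringKrullDim (R ⧸ J ⊔ Ideal.span {v}) + 1 ≤ ringKrullDim (R ⧸ J) := by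
  have e := DoubleQuot.quotQuotEquivQuotSup J (Ideal.span {v})
  rw [← ringKrullDim_eq_of_ringEquiv e]
  refine le_trans ?_ (ringKrullDim_quotient_add_height_le ((Ideal.span {v}).map (Ideal.Quotient.mk J)))
  gcongr
  rw [← WithBot.coe_one, WithBot.coe_le_coe, Ideal.map_span, Set.image_singleton]
  rw [Ideal.height_eq_inf_minimalPrimes]
  refine le_iInf₂ fun p hp ↦ ?_
  have := hp.isPrime
  rw [Order.one_le_iff_ne_zero, Ne, Ideal.height_eq_zero_iff]
  intro h
  have h1 : p.comap (Ideal.Quotient.mk J) ∈ J.minimalPrimes := by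
    rw [Ideal.minimalPrimes_eq_comap]
    exact ⟨p, h, rfl⟩
  exact hv _ h1 (hp.1.2 (Ideal.mem_span_singleton_self _))

lemma exists_mem_span_notMem_minimalPrimes {R K : Type} [CommRing R] [IsNoetherianRing R] [Field K]
    [Infinite K] [Algebra K R] (J : Ideal R) (X : Finset R)
    (hX : ∀ q ∈ J.minimalPrimes, ∃ x ∈ X, x ∉ q) :
    ∃ v ∈ Submodule.span K (X : Set R), ∀ q ∈ J.minimalPrimes, v ∉ q := by
  have hfin := Ideal.finite_minimalPrimes_of_isNoetherianRing R J
  have : Finite J.minimalPrimes := hfin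
  by_contra! h
  obtain ⟨q, hq⟩ := Subspace.exists_eq_top_of_iUnion_eq_univ (k := K) (E := Submodule.span K (X : Set R))
    (p := fun q : J.minimalPrimes ↦ (q.1.restrictScalars K).comap (Submodule.span K (X : Set R)).subtype) (by
      rw [Set.eq_univ_iff_forall]
      rintro ⟨v, hv⟩
      obtain ⟨q, hq, hvq⟩ := h v hv
      exact Set.mem_iUnion.2 ⟨⟨q, hq⟩, hvq⟩)
  obtain ⟨x, hxX, hxq⟩ := hX q.1 q.2
  have : (⟨x, Submodule.subset_span hxX⟩ : Submodule.span K (X : Set R)) ∈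
    (q.1.restrictScalars K).comap (Submodule.span K (X : Set R)).subtype := by rw [hq]; trivial
  exact hxq this

lemma exists_exchange {K R : Type} [CommRing R] [Field K] [Algebra K R] (X : Finset R) (v : R)
    (hv : v ∈ Submodule.span K (X : Set R)) (h0 : v ≠ 0) :
    ∃ x ∈ X, ∃ X' : Finset R, X'.card + 1 = X.card ∧
      (∀ y ∈ X, y = x ∨ y ∈ X') ∧ X' ⊆ X ∧ x ∈ Submodule.span K (insert v (X' : Set R)) := by
  classical
  induction X using Finset.induction_on with
  | empty => simp at hv; exact absurd hv h0
  | insert a X ha ih =>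
    by_cases hvX : v ∈ Submodule.span K (X : Set R)
    · obtain ⟨x, hx, X', hcard, h1, h2, h3⟩ := ih hvX
      refine ⟨x, Finset.mem_insert_of_mem hx, insert a X', ?_, ?_, Finset.insert_subset_insert _ h2, ?_⟩
      · rw [Finset.card_insert_of_notMem ha, Finset.card_insert_of_notMem fun h ↦ ha (h2 h), hcard]
      · intro y hy
        rcases Finset.mem_insert.1 hy with rfl | hy
        · simp
        · rcases h1 y hy with h | h <;> simp [h]
      · refine Submodule.span_mono ?_ h3
        rw [Finset.coe_insert]
        exact Set.insert_subset_insert (Set.subset_insert _ _)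
    · refine ⟨a, Finset.mem_insert_self _ _, X, by rw [Finset.card_insert_of_notMem ha], by simp,
        Finset.subset_insert _ _, ?_⟩
      rw [Finset.coe_insert] at hv
      exact mem_span_insert_exchange hv hvX

lemma exists_parameters {R K : Type} [CommRing R] [IsLocalRing R] [IsNoetherianRing R] [Field K]
    [Infinite K] [Algebra K R] (P : Ideal R) (hP : P ≠ ⊤) (n k : ℕ) :
    ∀ (Y X : Finset R), X.card = k → Ideal.span (Y ∪ X : Set R) = maximalIdeal R → Y.card + X.card ≤ n →
      (Y.card : WithBot ℕ∞) + ringKrullDim (R ⧸ P ⊔ Ideal.span (Y : Set R)) ≤ ringKrullDim (R ⧸ P) →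
    ∃ Y X : Finset R, Ideal.span (Y ∪ X : Set R) = maximalIdeal R ∧ Y.card + X.card ≤ n ∧
      (Y.card : WithBot ℕ∞) ≤ ringKrullDim (R ⧸ P) ∧
      maximalIdeal R ≤ (P ⊔ Ideal.span (Y : Set R)).radical := by
  classical
  induction k with
  | zero =>
    intro Y X hX hspan hcard hdim
    obtain rfl := Finset.card_eq_zero.1 hX
    have hY : Ideal.span (Y : Set R) = maximalIdeal R := by simpa using hspan
    have h1 : P ⊔ Ideal.span (Y : Set R) = maximalIdeal R := by rw [hY]; exact sup_eq_right.2 (le_maximalIdeal hP)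
    refine ⟨Y, ∅, hspan, hcard, le_trans ?_ hdim, h1 ▸ Ideal.le_radical⟩
    have : Nontrivial (R ⧸ P ⊔ Ideal.span (Y : Set R)) := by
      rw [Ideal.Quotient.nontrivial_iff, h1]; exact Ideal.IsPrime.ne_top'
    exact le_add_of_nonneg_right ringKrullDim_nonneg_of_nontrivial
  | succ k ih =>
    intro Y X hX hspan hcard hdim
    set J := P ⊔ Ideal.span (Y : Set R)
    have hJ : J ≤ maximalIdeal R := by
      refine sup_le (le_maximalIdeal hP) ?_
      rw [← hspan]
      exact Ideal.span_mono Set.subset_union_left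
    by_cases hrad : maximalIdeal R ≤ J.radical
    · refine ⟨Y, X, hspan, hcard, le_trans ?_ hdim, hrad⟩
      have : Nontrivial (R ⧸ J) := by
        rw [Ideal.Quotient.nontrivial_iff]
        exact fun h ↦ (maximalIdeal.isMaximal R).ne_top (top_le_iff.1 (h ▸ hJ))
      exact le_add_of_nonneg_right ringKrullDim_nonneg_of_nontrivial
    obtain ⟨v, hv, hvq⟩ := exists_mem_span_notMem_minimalPrimes (K := K) J X (by
      intro q hq
      by_contra! h
      have h1 : maximalIdeal R ≤ q := by
        rw [← hspan, Ideal.span_le]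
        rintro x (hx | hx)
        · exact hq.1.2 (Ideal.mem_sup_right (Ideal.subset_span hx))
        · exact h x hx
      refine hrad ?_
      rw [Ideal.radical_eq_sInf]
      refine le_sInf fun p hp ↦ ?_
      exact h1.trans (hq.2 ⟨hp.2, hp.1⟩ ((le_maximalIdeal hp.2.ne_top).trans h1)))
    obtain ⟨q, hq⟩ := Ideal.nonempty_minimalPrimes (I := J) fun h ↦ (maximalIdeal.isMaximal R).ne_top (top_le_iff.1 (h ▸ hJ))
    have hv0 : v ≠ 0 := fun h ↦ hvq q hq (h ▸ zero_mem q)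
    obtain ⟨x, hx, X', hcard', h1, h2, h3⟩ := exists_exchange X v hv hv0
    have hKR (T : Set R) : Submodule.span K T ≤ (Ideal.span T).restrictScalars K :=
      Submodule.span_le.2 Submodule.subset_span
    refine ih (insert v Y) X' (by omega) (le_antisymm ?_ ?_) ?_ ?_
    · rw [Ideal.span_le, Finset.coe_insert]
      have hm : ∀ T : Set R, T ⊆ Y ∪ X → Ideal.span T ≤ maximalIdeal R := fun T hT ↦ by
        rw [← hspan]; exact Ideal.span_mono hT
      rintro y ((rfl | hy) | hy)
      · exact hm _ Set.subset_union_right (hKR _ hv)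
      · exact hm _ Set.subset_union_left (Ideal.subset_span hy)
      · exact hm _ Set.subset_union_right (Ideal.subset_span (h2 hy))
    · rw [← hspan, Ideal.span_le, Finset.coe_insert]
      rintro y (hy | hy)
      · exact Ideal.subset_span (Or.inl (Or.inr hy))
      · rcases h1 y hy with rfl | hy
        · refine Ideal.span_mono ?_ (hKR _ h3)
          rintro z (rfl | hz)
          · exact Or.inl (Or.inl rfl)
          · exact Or.inr hz
        · exact Ideal.subset_span (Or.inr hy)
    · have := Finset.card_insert_le v Y
      omega
    · have h4 : P ⊔ Ideal.span ((insert v Y : Finset R) : Set R) = J ⊔ Ideal.span {v} := by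
        rw [Finset.coe_insert, Ideal.span_insert, sup_comm (Ideal.span {v}), ← sup_assoc]
      rw [h4]
      refine le_trans ?_ ((add_le_add_right (ringKrullDim_quotient_sup_span_singleton_add_one_le J v hvq) (Y.card : WithBot ℕ∞)).trans hdim)
      rw [add_comm (ringKrullDim _) 1, ← add_assoc]
      gcongr
      exact_mod_cast Finset.card_insert_le v Y

end Parameters

end FV

namespace FV

section Rigidity

open IsLocalRing

variable {R K B E : Type} [CommRing R] [IsLocalRing R] [IsNoetherianRing R] [Field K] [CommRing B]
  [Algebra K B] [Algebra B R] [CommRing E] [Algebra R E] [Algebra B E] [IsScalarTower B R E]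
  [Algebra K R] [IsScalarTower K B R]

omit [IsNoetherianRing R] [IsScalarTower B R E] [Algebra R E] in
lemma exists_mem_subalgebra_sub_mem_pow (hK : ∀ r : R, ∃ k : K, r - algebraMap K R k ∈ maximalIdeal R)
    (T : Subalgebra B R) (S : Set R) (hS : Ideal.span S = maximalIdeal R) (hST : S ⊆ T) (n : ℕ) (r : R) :
    ∃ t ∈ T, r - t ∈ maximalIdeal R ^ n := by
  have hKT (k : K) : algebraMap K R k ∈ T := by
    rw [IsScalarTower.algebraMap_apply K B R]
    exact T.algebraMap_mem _
  have h1 : ∀ a ∈ maximalIdeal R, ∃ t ∈ T, t ∈ maximalIdeal R ∧ a - t ∈ maximalIdeal R ^ 2 := by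
    intro a ha
    rw [← hS] at ha
    induction ha using Submodule.span_induction with
    | mem x hx => exact ⟨x, hST hx, hS ▸ Ideal.subset_span hx, by simp⟩
    | zero => exact ⟨0, zero_mem _, zero_mem _, by simp⟩
    | add x y _ _ hx hy =>
      obtain ⟨t, ht, htm, hxt⟩ := hx
      obtain ⟨s, hs, hsm, hys⟩ := hy
      exact ⟨t + s, add_mem ht hs, add_mem htm hsm, by rw [add_sub_add_comm]; exact add_mem hxt hys⟩
    | smul c x _ hx =>
      obtain ⟨t, ht, htm, hxt⟩ := hx
      obtain ⟨k, hk⟩ := hK c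
      refine ⟨algebraMap K R k * t, mul_mem (hKT k) ht, Ideal.mul_mem_left _ _ htm, ?_⟩
      have : c • x - algebraMap K R k * t = c * (x - t) + (c - algebraMap K R k) * t := by
        rw [smul_eq_mul]; ring
      rw [this]
      refine add_mem (Ideal.mul_mem_left _ _ hxt) ?_
      rw [pow_two]
      exact Ideal.mul_mem_mul hk htm
  have h2 : ∀ n, ∀ a ∈ maximalIdeal R ^ n,
      ∃ t ∈ T, t ∈ maximalIdeal R ^ n ∧ a - t ∈ maximalIdeal R ^ (n + 1) := by
    intro n
    induction n with
    | zero =>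
      intro a _
      obtain ⟨k, hk⟩ := hK a
      exact ⟨_, hKT k, by simp, by simpa using hk⟩
    | succ n ih =>
      intro a ha
      rw [pow_succ] at ha
      induction ha using Submodule.mul_induction_on' with
      | mem_mul_mem x hx y hy =>
        obtain ⟨t, ht, htm, hxt⟩ := ih x hx
        obtain ⟨s, hs, hsm, hys⟩ := h1 y hy
        refine ⟨t * s, mul_mem ht hs, by rw [pow_succ]; exact Ideal.mul_mem_mul htm hsm, ?_⟩
        have : x * y - t * s = (x - t) * y + t * (y - s) := by ring
        rw [this]
        refine add_mem ?_ ?_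
        · rw [pow_succ]; exact Ideal.mul_mem_mul hxt hy
        · rw [add_assoc, pow_add]; exact Ideal.mul_mem_mul htm hys
      | add x _ y _ hx hy =>
        obtain ⟨t, ht, htm, hxt⟩ := hx
        obtain ⟨s, hs, hsm, hys⟩ := hy
        exact ⟨t + s, add_mem ht hs, add_mem htm hsm, by rw [add_sub_add_comm]; exact add_mem hxt hys⟩
  induction n with
  | zero => exact ⟨0, zero_mem _, by simp⟩
  | succ n ih =>
    obtain ⟨t, ht, hrt⟩ := ih
    obtain ⟨s, hs, -, hts⟩ := h2 n _ hrt
    exact ⟨t + s, add_mem ht hs, by rwa [← sub_sub]⟩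

lemma algHom_eq_algebraMap [Module.Finite R E]
    (hK : ∀ r : R, ∃ k : K, r - algebraMap K R k ∈ maximalIdeal R)
    (v : R →ₐ[B] E) (Y : Set B) (X : Set R)
    (hXY : Ideal.span (algebraMap B R '' Y ∪ X) = maximalIdeal R)
    (hX : ∀ x ∈ X, v x = algebraMap R E x) (P : Ideal R) (hP : ∀ p ∈ P, v p = 0) (N : ℕ)
    (hN : maximalIdeal R ^ N ≤ P ⊔ Ideal.span (algebraMap B R '' Y)) (r : R) :
    v r = algebraMap R E r := by
  let T : Subalgebra B R := AlgHom.equalizer v (IsScalarTower.toAlgHom B R E)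
  have hT : algebraMap B R '' Y ∪ X ⊆ T := by
    rintro x (⟨y, -, rfl⟩ | hx)
    · exact T.algebraMap_mem y
    · exact hX x hx
  set M := (maximalIdeal R).map (algebraMap R E)
  have hvN : maximalIdeal R ^ (N + 1) ≤ M.comap v := by
    refine (Ideal.pow_le_pow_right N.le_succ).trans (hN.trans (sup_le (fun p hp ↦ ?_) ?_))
    · rw [Ideal.mem_comap, hP p hp]; exact zero_mem _
    · rw [Ideal.span_le]
      rintro _ ⟨y, hy, rfl⟩
      change v _ ∈ M
      rw [v.commutes, IsScalarTower.algebraMap_apply B R E]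
      refine Ideal.mem_map_of_mem _ ?_
      rw [← hXY]
      exact Ideal.subset_span (Or.inl ⟨y, hy, rfl⟩)
  have huN : maximalIdeal R ^ (N + 1) ≤ M.comap (algebraMap R E) :=
    (Ideal.pow_le_self N.succ_ne_zero).trans Ideal.le_comap_map
  have key (k : ℕ) : v r - algebraMap R E r ∈ M ^ k := by
    obtain ⟨t, ht, hrt⟩ := exists_mem_subalgebra_sub_mem_pow hK T _ hXY hT ((N + 1) * k) r
    have h1 : v t = algebraMap R E t := ht
    have h2 : v r - algebraMap R E r = v (r - t) - algebraMap R E (r - t) := by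
      rw [map_sub, map_sub, h1]; ring
    rw [h2]
    rw [pow_mul] at hrt
    exact sub_mem (((Ideal.pow_right_mono hvN k).trans (Ideal.le_comap_pow v k)) hrt)
      (((Ideal.pow_right_mono huN k).trans (Ideal.le_comap_pow (algebraMap R E) k)) hrt)
  have hH : IsHausdorff M E := IsHausdorff.map_algebraMap_iff.2 (inferInstanceAs (IsHausdorff (maximalIdeal R) E))
  rw [← sub_eq_zero]
  refine hH.haus _ fun n ↦ ?_
  rw [SModEq.zero, smul_eq_mul, Ideal.mul_top]
  exact key n

end Rigidity

end FV

namespace FV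

section Conjugates

open Polynomial

variable (B A : Type) [CommRing B] [IsDomain B] [IsIntegrallyClosed B] [CommRing A] [IsDomain A]
  [Algebra B A] [Module.Finite B A]

attribute [local instance] FractionRing.liftAlgebra in
lemma exists_conjugates (hBA : Function.Injective (algebraMap B A)) :
    ∃ (D : Type) (_ : CommRing D) (_ : Algebra B D) (ι : Type) (τ : ι → A →ₐ[B] D),
      Finite ι ∧ Module.Finite B D ∧ Function.Injective (algebraMap B D) ∧
      ∀ a : A, ∃ (f : B[X]) (s : Multiset ι), aeval a f = 0 ∧
        f.map (algebraMap B D) = (s.map fun i ↦ X - C (τ i a)).prod := by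
  classical
  have : FaithfulSMul B A := (faithfulSMul_iff_algebraMap_injective B A).2 hBA
  have : Module.IsTorsionFree B A := inferInstance
  let F := FractionRing B
  let L := FractionRing A
  let Ω := AlgebraicClosure L
  have hfin : FiniteDimensional F L := inferInstance
  let τ₀ (i : L →ₐ[F] Ω) : A →ₐ[B] Ω := (i.restrictScalars B).comp (IsScalarTower.toAlgHom B A L)
  obtain ⟨g, hg⟩ := (Algebra.FiniteType.out : (⊤ : Subalgebra B A).FG)
  let Z : Set Ω := ⋃ i, τ₀ i '' g
  have hZfin : Z.Finite := Set.finite_iUnion fun i ↦ g.finite_toSet.image _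
  have hZint : ∀ z ∈ Z, IsIntegral B z := by
    intro z hz
    obtain ⟨i, a, -, rfl⟩ := Set.mem_iUnion.1 hz
    exact (Algebra.IsIntegral.isIntegral a).map (τ₀ i)
  let D := Algebra.adjoin B Z
  have hD (i) : (τ₀ i).range ≤ D := by
    rw [← Algebra.map_top, ← hg, AlgHom.map_adjoin]
    exact Algebra.adjoin_mono (Set.subset_iUnion (fun i ↦ τ₀ i '' (g : Set A)) i)
  let τ (i) : A →ₐ[B] D := (τ₀ i).codRestrict D fun a ↦ hD i ⟨a, rfl⟩
  have hinj : Function.Injective (algebraMap B Ω) := by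
    rw [IsScalarTower.algebraMap_eq B L Ω]
    exact (algebraMap L Ω).injective.comp (FaithfulSMul.algebraMap_injective B L)
  refine ⟨D, inferInstance, inferInstance, L →ₐ[F] Ω, τ, inferInstance, ?_, ?_, fun a ↦ ?_⟩
  · exact Module.Finite.iff_fg.2 (fg_adjoin_of_finite hZfin hZint)
  · refine Function.Injective.of_comp (f := algebraMap D Ω) ?_
    rwa [← RingHom.coe_comp, ← IsScalarTower.algebraMap_eq]
  · have ha : IsIntegral B a := Algebra.IsIntegral.isIntegral a
    let f := minpoly B a
    have hf : minpoly F (algebraMap A L a) = f.map (algebraMap B F) :=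
      minpoly.isIntegrallyClosed_eq_field_fractions F L ha
    have hfΩ : f.map (algebraMap B Ω) = (minpoly F (algebraMap A L a)).map (algebraMap F Ω) := by
      rw [hf, Polynomial.map_map, ← IsScalarTower.algebraMap_eq]
    have hroot : ∀ z ∈ (f.map (algebraMap B Ω)).roots, ∃ i, τ₀ i a = z := by
      intro z hz
      have : z ∈ (minpoly F (algebraMap A L a)).rootSet Ω := by
        rw [Polynomial.rootSet, aroots_def, ← hfΩ]; simpa using hz
      rw [← Algebra.IsAlgebraic.range_eval_eq_rootSet_minpoly] at this
      exact this
    choose! e he using hroot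
    refine ⟨f, (f.map (algebraMap B Ω)).roots.map e, minpoly.aeval B a, ?_⟩
    apply Polynomial.map_injective (algebraMap D Ω) Subtype.val_injective
    rw [Polynomial.map_map, ← IsScalarTower.algebraMap_eq, Polynomial.map_multiset_prod,
      Multiset.map_map, Multiset.map_map]
    conv_lhs => rw [(IsAlgClosed.splits (f.map (algebraMap B Ω))).eq_prod_roots_of_monic
      ((minpoly.monic ha).map _)]
    congr 1
    refine Multiset.map_congr rfl fun z hz ↦ ?_
    simp only [Function.comp, Polynomial.map_sub, map_X, map_C]
    congr 2
    exact (he z hz).symm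

end Conjugates

end FV

namespace FV

section Split

open IsLocalRing TensorProduct PrimeSpectrum

variable {R K B : Type} [CommRing R] [IsLocalRing R] [IsNoetherianRing R] [Field K] [Infinite K]
  [CommRing B] [IsDomain B] [IsIntegrallyClosed B] [Algebra K B] [Algebra B R]
  [Algebra K R] [IsScalarTower K B R]

lemma hasSplit_of_finite_quotient (hK : ∀ r : R, ∃ k : K, r - algebraMap K R k ∈ maximalIdeal R)
    (P : Ideal R) [P.IsPrime] [Module.Finite B (R ⧸ P)]
    (hinj : Function.Injective (algebraMap B (R ⧸ P))) (Y : Set B) (X : Finset R)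
    (hXY : Ideal.span (algebraMap B R '' Y ∪ X) = maximalIdeal R) (N : ℕ)
    (hN : maximalIdeal R ^ N ≤ P ⊔ Ideal.span (algebraMap B R '' Y)) {c : ℕ} (hc : X.card ≤ c) :
    HasSplit R P c := by
  classical
  obtain ⟨D, _, _, ι, τ, _, _, hBD, hτ⟩ := exists_conjugates B (R ⧸ P) hinj
  have := Fintype.ofFinite ι
  let R' := R ⊗[B] D
  let w (i : ι) : R →ₐ[B] R' :=
    Algebra.TensorProduct.includeRight.comp ((τ i).comp (IsScalarTower.toAlgHom B R (R ⧸ P)))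
  have hwP (i) : ∀ p ∈ P, w i p = 0 := by
    intro p hp
    have : (algebraMap R (R ⧸ P)) p = 0 := Ideal.Quotient.eq_zero_iff_mem.2 hp
    change Algebra.TensorProduct.includeRight (τ i (algebraMap R (R ⧸ P) p)) = 0
    rw [this, map_zero, map_zero]
  let T (i : ι) : Finset R' := X.image fun x ↦ algebraMap R R' x - w i x
  refine ⟨R', inferInstance, inferInstance, ι, Finset.univ, fun i ↦ Ideal.span (T i), inferInstance,
    ?_, fun i _ ↦ ⟨T i, rfl, Finset.card_image_le.trans hc⟩, fun q hq ↦ ⟨fun hPq ↦ ?_, ?_⟩⟩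
  · refine comap_surjective_baseChange B D R ?_
    intro p
    obtain ⟨Q, -, hQ, hQp⟩ := Ideal.exists_ideal_over_prime_of_isIntegral p.asIdeal (⊥ : Ideal D)
      (by rw [← RingHom.ker_eq_comap_bot, (RingHom.injective_iff_ker_eq_bot _).1 hBD]; exact bot_le)
    exact ⟨⟨Q, hQ⟩, PrimeSpectrum.ext hQp⟩
  · let V (i : ι) : Subspace K R := ((q.restrictScalars B).comap
      ((IsScalarTower.toAlgHom B R R').toLinearMap - (w i).toLinearMap)).restrictScalars K
    have hV (i : ι) (r : R) : r ∈ V i ↔ algebraMap R R' r - w i r ∈ q := Iff.rfl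
    obtain ⟨i, hi⟩ : ∃ i, V i = ⊤ := by
      apply Subspace.exists_eq_top_of_iUnion_eq_univ
      refine Set.eq_univ_of_forall fun r ↦ Set.mem_iUnion.2 ?_
      obtain ⟨f, s, hf, hfs⟩ := hτ (algebraMap R (R ⧸ P) r)
      have hfr : Polynomial.aeval r f ∈ P := by
        rw [Polynomial.aeval_algebraMap_apply] at hf
        exact Ideal.Quotient.eq_zero_iff_mem.1 hf
      have h1 : algebraMap R R' (Polynomial.aeval r f) ∈ q := hPq (Ideal.mem_map_of_mem _ hfr)
      have h2 : algebraMap R R' (Polynomial.aeval r f) =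
          (s.map fun i ↦ algebraMap R R' r - w i r).prod := by
        have h3 := congrArg (Polynomial.eval₂
          (Algebra.TensorProduct.includeRight : D →ₐ[B] R').toRingHom (algebraMap R R' r)) hfs
        rw [Polynomial.eval₂_map] at h3
        rw [← Polynomial.aeval_algebraMap_apply, Polynomial.aeval_def]
        convert h3 using 1
        · congr 1
          ext b
          exact ((Algebra.TensorProduct.includeRight : D →ₐ[B] R').commutes b).symm
        · rw [← Polynomial.coe_eval₂RingHom, map_multiset_prod, Multiset.map_map]
          congr 1
          refine Multiset.map_congr rfl fun i _ ↦ ?_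
          simp only [Function.comp, Polynomial.coe_eval₂RingHom, Polynomial.eval₂_sub,
            Polynomial.eval₂_X, Polynomial.eval₂_C]
          rfl
      rw [h2] at h1
      obtain ⟨a, ha, haq⟩ := (hq.multiset_prod_mem_iff_exists_mem _).1 h1
      obtain ⟨i, -, rfl⟩ := Multiset.mem_map.1 ha
      exact ⟨i, haq⟩
    refine ⟨i, Finset.mem_univ _, Ideal.span_le.2 fun t ht ↦ ?_⟩
    obtain ⟨x, -, rfl⟩ := Finset.mem_image.1 (Finset.mem_coe.1 ht)
    exact (hV i x).1 (hi ▸ Submodule.mem_top)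
  · rintro ⟨i, -, hi⟩
    rw [Ideal.map_le_iff_le_comap]
    intro p hp
    refine hi ?_
    let E := R' ⧸ Ideal.span (T i : Set R')
    have : Module.Finite R E := Module.Finite.trans R' E
    let v : R →ₐ[B] E := (IsScalarTower.toAlgHom B R' E).comp (w i)
    have hv := algHom_eq_algebraMap (E := E) hK v Y X hXY ?_ P ?_ N hN p
    · have hv0 : v p = 0 := by
        change algebraMap R' E (w i p) = 0
        rw [hwP i p hp, map_zero]
      rw [hv0] at hv
      exact Ideal.Quotient.eq_zero_iff_mem.1 hv.symm
    · intro x hx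
      have : algebraMap R R' x - w i x ∈ Ideal.span (T i : Set R') :=
        Ideal.subset_span (Finset.mem_coe.2 (Finset.mem_image_of_mem _ hx))
      exact (Ideal.Quotient.mk_eq_mk_iff_sub_mem _ _).2 this |>.symm
    · intro p hp
      change algebraMap R' E (w i p) = 0
      rw [hwP i p hp, map_zero]

end Split

end FV

namespace FV

section Regular

open IsLocalRing

variable {R K : Type} [CommRing R] [IsLocalRing R] [IsNoetherianRing R] [Field K]
  [Algebra K R] [IsAdicComplete (maximalIdeal R) R]

lemma isDomain_of_card_eq_ringKrullDim (hK : ∀ r : R, ∃ k : K, r - algebraMap K R k ∈ maximalIdeal R)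
    (G : Finset R) (hG : Ideal.span (G : Set R) = maximalIdeal R)
    (hdim : (G.card : WithBot ℕ∞) ≤ ringKrullDim R) : IsDomain R := by
  have hmem (i : G) : i.1 ∈ maximalIdeal R := hG ▸ Ideal.subset_span i.2
  obtain ⟨_, _, hX⟩ := exists_algebra_mvPowerSeries (K := K) (σ := G) (maximalIdeal R)
    (fun i ↦ i.1) hmem
  let B := MvPowerSeries G K
  have hspan : Ideal.span (Set.range fun i : G ↦ algebraMap B R (MvPowerSeries.X i)) =
      maximalIdeal R := by
    simp_rw [B, hX]
    rw [← hG]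
    simp
  have hs := surjective_algebraMap_quotient (σ := G) hK (fun i ↦ by rw [hX]; exact hmem i) ⊥
    (by rw [hspan]; exact le_sup_right)
  have hs' : Function.Surjective (algebraMap B R) := by
    intro r
    obtain ⟨b, hb⟩ := hs (Ideal.Quotient.mk ⊥ r)
    refine ⟨b, ?_⟩
    have := (Ideal.Quotient.mk_eq_mk_iff_sub_mem (algebraMap B R b) r).1 hb
    rwa [Ideal.mem_bot, sub_eq_zero] at this
  have : Module.Finite B R := Module.Finite.of_surjective (Algebra.linearMap B R) hs'
  have hB := ringKrullDim_mvPowerSeries_le K G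
  rw [Fintype.card_coe] at hB
  have hinj := injective_of_isIntegral_of_le_ringKrullDim (B := B) hB hdim
  let e := RingEquiv.ofBijective (algebraMap B R) ⟨hinj, hs'⟩
  exact e.symm.toMulEquiv.isDomain _

lemma hasSplit_of_height_le [IsDomain R] [Infinite K]
    (hK : ∀ r : R, ∃ k : K, r - algebraMap K R k ∈ maximalIdeal R)
    (G : Finset R) (hG : Ideal.span (G : Set R) = maximalIdeal R)
    (hdim : (G.card : WithBot ℕ∞) ≤ ringKrullDim R) (P : Ideal R) [hP : P.IsPrime] {c : ℕ}
    (hc : P.height ≤ c) : HasSplit R P c := by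
  classical
  obtain ⟨Y, X, hXY, hcard, hY, hrad⟩ := exists_parameters (K := K) P hP.ne_top G.card G.card ∅ G rfl
    (by simpa using hG) (by simp) (by
      rw [Finset.card_empty, Nat.cast_zero, zero_add, Finset.coe_empty, Ideal.span_empty, sup_bot_eq])
  have hmem (i : Y) : i.1 ∈ maximalIdeal R := hXY ▸ Ideal.subset_span (Or.inl i.2)
  obtain ⟨_, _, hX⟩ := exists_algebra_mvPowerSeries (K := K) (σ := Y) (maximalIdeal R)
    (fun i ↦ i.1) hmem
  let B := MvPowerSeries Y K
  have himg : algebraMap B R '' (Set.range (MvPowerSeries.X : Y → B)) = Y := by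
    rw [← Set.range_comp]
    change (Set.range fun i : Y ↦ algebraMap B R (MvPowerSeries.X i)) = _
    simp_rw [B, hX]
    simp
  have hspan : (Set.range fun i : Y ↦ algebraMap B R (MvPowerSeries.X i)) = Y := by
    simp_rw [B, hX]
    simp
  obtain ⟨N, hN⟩ := Ideal.exists_pow_le_of_le_radical_of_fg hrad (IsNoetherian.noetherian _)
  have hfin : Module.Finite B (R ⧸ P) := by
    refine finite_of_pow_le hK (fun i ↦ by rw [hX]; exact hmem i) (R ⧸ P) P.mkQ
      P.mkQ_surjective N fun r hr ↦ ?_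
    rw [hspan]
    obtain ⟨p, hp, y, hy, rfl⟩ := Submodule.mem_sup.1 (hN hr)
    rw [map_add, (Submodule.Quotient.mk_eq_zero P).2 hp |> (show P.mkQ p = 0 from ·), zero_add]
    have : P.mkQ y = y • P.mkQ 1 := by rw [← map_smul, smul_eq_mul, mul_one]
    rw [this]
    exact Submodule.smul_mem_smul hy Submodule.mem_top
  have hB := ringKrullDim_mvPowerSeries_le K Y
  rw [Fintype.card_coe] at hB
  have hinj := injective_of_isIntegral_of_le_ringKrullDim (B := B) (S := R ⧸ P) hB hY
  refine hasSplit_of_finite_quotient (B := B) hK P hinj (Set.range MvPowerSeries.X) X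
    (by rw [himg]; exact hXY) N (by rw [himg]; exact hN) ?_
  have hA : ringKrullDim (R ⧸ P) ≤ Y.card := (ringKrullDim_le_of_isIntegral B (R ⧸ P)).trans hB
  have h1 : ((X.card + Y.card : ℕ) : WithBot ℕ∞) ≤ (c : WithBot ℕ∞) + Y.card := by
    calc ((X.card + Y.card : ℕ) : WithBot ℕ∞) ≤ G.card := by exact_mod_cast (add_comm X.card _ ▸ hcard)
      _ ≤ ringKrullDim R := hdim
      _ ≤ P.height + ringKrullDim (R ⧸ P) := ringKrullDim_le_height_add hK P
      _ ≤ _ := add_le_add (by exact_mod_cast hc) hA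
  have h2 : X.card + Y.card ≤ c + Y.card := by exact_mod_cast h1
  omega

end Regular

end FV

namespace FV

section CoefficientField

open MvPolynomial Algebra IsLocalRing

lemma subsingleton_h1Cotangent_iff_forall_mem_pow (k A : Type) [CommRing k] [CommRing A] [Algebra k A] :
    Subsingleton (H1Cotangent k A) ↔ ∀ f : MvPolynomial A k, aeval (R := k) (id : A → A) f = 0 →
      (∀ i, aeval (R := k) (id : A → A) (pderiv i f) = 0) →
      f ∈ RingHom.ker (aeval (R := k) (id : A → A)) ^ 2 := by
  let G := Generators.self k A
  change Subsingleton G.toExtension.H1Cotangent ↔ _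
  have hker : G.ker = RingHom.ker (aeval (R := k) (id : A → A)) := G.ker_eq_ker_aeval_val
  have h0 (f : G.toExtension.ker) : G.toExtension.cotangentComplex (Extension.Cotangent.mk f) = 0 ↔
      ∀ i, aeval (R := k) (id : A → A) (pderiv i f.1) = 0 := by
    rw [Extension.cotangentComplex_mk, ← G.cotangentSpaceBasis.repr.map_eq_zero_iff, Finsupp.ext_iff]
    refine forall_congr' fun i ↦ ?_
    rw [show G.cotangentSpaceBasis.repr _ i = _ from G.cotangentSpaceBasis_repr_one_tmul f.1 i]
    rfl
  rw [Extension.subsingleton_h1Cotangent, injective_iff_map_eq_zero]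
  constructor
  · intro h f hf hd
    have hf' : f ∈ G.ker := hker ▸ hf
    have := (Extension.Cotangent.mk_eq_zero_iff _).1 (h (Extension.Cotangent.mk ⟨f, hf'⟩) ((h0 _).2 hd))
    rw [← hker]
    exact this
  · intro h x hx
    obtain ⟨f, rfl⟩ := Extension.Cotangent.mk_surjective x
    rw [Extension.Cotangent.mk_eq_zero_iff]
    have hf : f.1 ∈ RingHom.ker (aeval (R := k) (id : A → A)) := hker ▸ f.2
    have := h f.1 hf ((h0 f).1 hx)
    rw [← hker] at this
    exact this

lemma infinite_of_isSepClosed (K : Type) [Field K] [IsSepClosed K] : Infinite K := by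
  by_contra h
  have : Finite K := not_infinite_iff_finite.1 h
  have : IsAlgClosed K := IsSepClosed.isAlgClosed_of_perfectField K
  exact h inferInstance

lemma formallySmooth_of_perfectField (k L : Type) [Field k] [Field L] [Algebra k L] [PerfectField k] :
    FormallySmooth k L := by
  refine ⟨inferInstance, (subsingleton_h1Cotangent_iff_forall_mem_pow k L).2 fun f hf hd ↦ ?_⟩
  let E := IntermediateField.adjoin k (f.vars : Set L)
  have : EssFiniteType k E := IntermediateField.essFiniteType_iff.2 ⟨f.vars, rfl⟩
  have hE := (subsingleton_h1Cotangent_iff_forall_mem_pow k E).1 inferInstance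
  obtain ⟨g, hgf⟩ := exists_rename_eq_of_vars_subset_range f (Subtype.val : E → L)
    Subtype.val_injective (by rw [Subtype.range_coe]; exact IntermediateField.subset_adjoin k (f.vars : Set L))
  have hcomp (h : MvPolynomial E k) : aeval (R := k) (id : L → L) (rename Subtype.val h) =
      algebraMap E L (aeval (R := k) (id : E → E) h) := by
    rw [aeval_rename, ← aeval_algebraMap_apply]
    rfl
  have hz (h : MvPolynomial E k) (hh : aeval (R := k) (id : L → L) (rename Subtype.val h) = 0) :
      aeval (R := k) (id : E → E) h = 0 := by
    rw [hcomp] at hh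
    exact (map_eq_zero_iff _ (algebraMap E L).injective).1 hh
  have hg := hE g (hz g (hgf ▸ hf)) fun i ↦ hz _ (by
    rw [← pderiv_rename Subtype.val_injective, hgf]
    exact hd i)
  have hle : (RingHom.ker (aeval (R := k) (id : E → E))).map (rename (R := k) (Subtype.val : E → L)) ≤
      RingHom.ker (aeval (R := k) (id : L → L)) := by
    rw [Ideal.map_le_iff_le_comap]
    intro h hh
    rw [Ideal.mem_comap, RingHom.mem_ker, hcomp, (RingHom.mem_ker).1 hh, map_zero]
  refine Ideal.pow_right_mono hle 2 ?_
  rw [← Ideal.map_pow, ← hgf]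
  exact Ideal.mem_map_of_mem _ hg

lemma exists_perfectField_algebra (k R : Type) [Field k] [CommRing R] [Algebra k R] :
    ∃ (k₀ : Type) (_ : Field k₀) (_ : PerfectField k₀), Nonempty (Algebra k₀ R) := by
  obtain ⟨p, hp⟩ := CharP.exists k
  rcases CharP.char_is_prime_or_zero k p with h | rfl
  · have : Fact p.Prime := ⟨h⟩
    let _ : Algebra (ZMod p) k := ZMod.algebra k p
    exact ⟨ZMod p, inferInstance, inferInstance, ⟨((algebraMap k R).comp (algebraMap (ZMod p) k)).toAlgebra⟩⟩
  · have : CharZero k := CharP.charP_to_charZero k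
    exact ⟨ℚ, inferInstance, inferInstance, ⟨((algebraMap k R).comp (algebraMap ℚ k)).toAlgebra⟩⟩

lemma exists_algebra_residueField (k R : Type) [Field k] [CommRing R] [IsLocalRing R] [Algebra k R]
    [IsAdicComplete (maximalIdeal R) R] :
    ∃ _ : Algebra (ResidueField R) R,
      ∀ r : R, ∃ a : ResidueField R, r - algebraMap (ResidueField R) R a ∈ maximalIdeal R := by
  obtain ⟨k₀, _, _, ⟨_⟩⟩ := exists_perfectField_algebra k R
  have := formallySmooth_of_perfectField k₀ (ResidueField R)
  obtain ⟨g, hg⟩ := FormallySmooth.exists_mkₐ_comp_eq_of_isAdicComplete (R := k₀)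
    (A := ResidueField R) (I := maximalIdeal R)
    (AlgHom.id k₀ (ResidueField R) : ResidueField R →ₐ[k₀] R ⧸ maximalIdeal R)
  refine ⟨g.toRingHom.toAlgebra, fun r ↦ ⟨residue R r, ?_⟩⟩
  refine (Ideal.Quotient.mk_eq_mk_iff_sub_mem _ _).1 ?_
  exact (DFunLike.congr_fun hg (residue R r)).symm

end CoefficientField

end FV

/-- **Faltings vanishing.** Let `R` be a complete equicharacteristic (i.e. containing a field)
Noetherian regular local ring of dimension `n` with separably closed residue field, and let `I`
be a nonzero proper ideal whose minimal primes have maximal height `c`.  Then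
`H^j_I(R) = 0` for all `j > n - ⌊(n-1)/c⌋`. -/
theorem faltings_vanishing
    (R : Type) [CommRing R] [IsNoetherianRing R] [IsLocalRing R]
    (hreg : ∃ s : Finset R, Ideal.span (s : Set R) = IsLocalRing.maximalIdeal R ∧
      (s.card : WithBot ℕ∞) = ringKrullDim R)
    [IsAdicComplete (IsLocalRing.maximalIdeal R) R]
    (k : Type) [Field k] [Algebra k R]
    [IsSepClosed (IsLocalRing.ResidueField R)]
    (n : ℕ) (hn : (n : WithBot ℕ∞) = ringKrullDim R)
    (I : Ideal R) (hI0 : I ≠ ⊥) (hItop : I ≠ ⊤)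
    (c : ℕ)
    (hcub : ∀ P : PrimeSpectrum R, P.asIdeal ∈ I.minimalPrimes → Order.height P ≤ (c : ℕ∞))
    (hcmax : ∃ P : PrimeSpectrum R, P.asIdeal ∈ I.minimalPrimes ∧ Order.height P = (c : ℕ∞))
    (j : ℕ) (hj : n - (n - 1) / c < j) :
    Subsingleton ((localCohomology I j).obj (ModuleCat.of R R)) := by
  obtain ⟨G, hG, hGdim⟩ := hreg
  obtain ⟨_, hK⟩ := FV.exists_algebra_residueField k R
  have : IsDomain R := FV.isDomain_of_card_eq_ringKrullDim hK G hG hGdim.le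
  have : Infinite (IsLocalRing.ResidueField R) := FV.infinite_of_isSepClosed _
  refine FV.subsingleton_of_hasSplit hn.ge (fun P hP ↦ ?_) j hj
  have hPp : P.IsPrime := hP.1.1
  refine FV.hasSplit_of_height_le hK G hG hGdim.le P ?_
  have := hcub ⟨P, hPp⟩ hP
  rwa [← PrimeSpectrum.height_eq_orderHeight] at this
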